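/- arXiv:2510.25719 — 7 statements merged into one kernel-verified Lean document; each statement's English description precedes it below -/
import Mathlib

section
/- Extension of Williamson's theorem (Theorem 5.4): Let M and Q be (2n×2n) real symmetric matrices such that M is positive definite and Q commutes with Ω_n. Then the following are equivalent: (a) there exist a symplectic matrix S, non-negative reals ν_1,…,ν_n and reals q_1,…,q_n such that S * M * Sᵀ = blockdiag(ν_j·I₂) and S * Q * Sᵀ = blockdiag(q_j·I₂); (b) the matrices Ω_n * M and Ω_n * Q commute. -/
open Matrix

noncomputable section

/-- The 2×2 standard symplectic form `Ω₁ = !![0,1; -1,0]`. -/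
def Omega1 : Matrix (Fin 2) (Fin 2) ℝ := !![0, 1; -1, 0]

/-- The 2n×2n standard symplectic form `Ω_n`, a block-diagonal matrix with `n` copies of `Ω₁`. -/
def OmegaN (n : ℕ) : Matrix (Fin 2 × Fin n) (Fin 2 × Fin n) ℝ :=
  Matrix.blockDiagonal fun _ => Omega1

/-- A real 2n×2n matrix is symplectic if `S * Ω_n * Sᵀ = Ω_n`. -/
def IsSymplectic {n : ℕ} (S : Matrix (Fin 2 × Fin n) (Fin 2 × Fin n) ℝ) : Prop :=
  S * OmegaN n * Sᵀ = OmegaN n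

section helpers

open scoped MatrixOrder in
lemma posDef_factor {ι : Type*} [Fintype ι] [DecidableEq ι] (M : Matrix ι ι ℝ) (h : M.PosDef) :
    ∃ y z : Matrix ι ι ℝ, M = yᵀ * y ∧ y * z = 1 ∧ z * y = 1 := by
  obtain ⟨y, hy, h2⟩ := CStarAlgebra.isStrictlyPositive_iff_eq_star_mul_self.mp
        h.isStrictlyPositive
  obtain ⟨u, rfl⟩ := hy
  exact ⟨u, ↑u⁻¹, by rw [h2, star_eq_conjTranspose, conjTranspose_eq_transpose_of_trivial],
    by simp, by simp⟩

variable {V : Type*} [NormedAddCommGroup V] [InnerProductSpace ℝ V] [FiniteDimensional ℝ V]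

lemma exists_eig (T : V →ₗ[ℝ] V) (hT : T.IsSymmetric) (W : Submodule ℝ V) (hW : W ≠ ⊥)
    (hinv : ∀ w ∈ W, T w ∈ W) : ∃ μ : ℝ, ∃ v ∈ W, v ≠ 0 ∧ T v = μ • v := by
  have hs := hT.restrict_invariant hinv
  haveI : Nontrivial W := Submodule.nontrivial_iff_ne_bot.mpr hW
  obtain ⟨μ, hμ⟩ : ∃ μ : ℝ, Module.End.HasEigenvalue (T.restrict hinv) μ :=
    ⟨_, hs.hasEigenvalue_iSup_of_finiteDimensional⟩
  obtain ⟨v, hv⟩ := hμ.exists_hasEigenvector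
  refine ⟨μ, v, v.2, ?_, ?_⟩
  · simpa using hv.2
  · have := congrArg Subtype.val hv.apply_eq_smul
    exact this

lemma exists_family (A B : V →ₗ[ℝ] V) (hA : ∀ x y, inner ℝ (A x) y = - inner ℝ x (A y))
    (hAinj : ∀ x, A x = 0 → x = 0) (hB : B.IsSymmetric) (hAB : ∀ x, A (B x) = B (A x)) (k : ℕ)
    (hk : 2 * k ≤ Module.finrank ℝ V) :
    ∃ (e f : Fin k → V) (a b : Fin k → ℝ), (∀ j, 0 < a j) ∧
      (∀ i j, inner ℝ (e i) (e j) = if i = j then (1:ℝ) else 0) ∧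
      (∀ i j, inner ℝ (f i) (f j) = if i = j then (1:ℝ) else 0) ∧
      (∀ i j, inner ℝ (e i) (f j) = (0:ℝ)) ∧
      (∀ j, A (e j) = - a j • f j) ∧ (∀ j, A (f j) = a j • e j) ∧
      (∀ j, B (e j) = b j • e j) ∧ (∀ j, B (f j) = b j • f j) := by
  induction k with
  | zero =>
    exact ⟨Fin.elim0, Fin.elim0, Fin.elim0, Fin.elim0, by simp, by simp, by simp, by simp,
      by simp, by simp, by simp, by simp⟩
  | succ k ih =>
    obtain ⟨e, f, a, b, ha, hee, hff, hef, hAe, hAf, hBe, hBf⟩ := ih (by omega)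
    set U : Submodule ℝ V := Submodule.span ℝ (Set.range (Sum.elim e f)) with hU
    have hUfin : Module.finrank ℝ U < Module.finrank ℝ V := by
      have := finrank_range_le_card (R := ℝ) (Sum.elim e f)
      simp only [Set.finrank, Fintype.card_sum, Fintype.card_fin] at this
      rw [← hU] at this
      omega
    have hW : Uᗮ ≠ ⊥ := by
      intro h
      rw [Submodule.orthogonal_eq_bot_iff] at h
      rw [h, finrank_top] at hUfin
      exact lt_irrefl _ hUfin
    have memW : ∀ x, x ∈ Uᗮ ↔ (∀ j, inner ℝ (e j) x = (0:ℝ)) ∧ (∀ j, inner ℝ (f j) x = (0:ℝ)) := by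
      intro x
      rw [Submodule.mem_orthogonal]
      constructor
      · intro h
        exact ⟨fun j => h _ (Submodule.subset_span ⟨Sum.inl j, rfl⟩),
          fun j => h _ (Submodule.subset_span ⟨Sum.inr j, rfl⟩)⟩
      · rintro ⟨h1, h2⟩ u hu
        induction hu using Submodule.span_induction with
        | mem x hx =>
          obtain ⟨j | j, rfl⟩ := hx
          · exact h1 j
          · exact h2 j
        | zero => simp
        | add x y _ _ hx hy => rw [inner_add_left, hx, hy, add_zero]
        | smul c x _ hx => rw [inner_smul_left, hx, mul_zero]
    have hA' : ∀ x y, inner ℝ x (A y) = - inner ℝ (A x) y := fun x y => by rw [hA]; ring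
    have AW : ∀ x ∈ Uᗮ, A x ∈ Uᗮ := by
      intro x hx
      rw [memW] at hx ⊢
      constructor
      · intro j
        rw [hA', hAe, inner_smul_left, hx.2, mul_zero, neg_zero]
      · intro j
        rw [hA', hAf, inner_smul_left, hx.1, mul_zero, neg_zero]
    have BW : ∀ x ∈ Uᗮ, B x ∈ Uᗮ := by
      intro x hx
      rw [memW] at hx ⊢
      constructor
      · intro j
        rw [← hB, hBe, inner_smul_left, hx.1, mul_zero]
      · intro j
        rw [← hB, hBf, inner_smul_left, hx.2, mul_zero]
    obtain ⟨μ, v₀, hv₀W, hv₀, hv₀μ⟩ := exists_eig (A ∘ₗ A)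
      (fun x y => by simp [hA]) Uᗮ hW (fun w hw => AW _ (AW _ hw))
    obtain ⟨β, v₁, hv₁W, hv₁, hv₁β⟩ := exists_eig B hB
      (Uᗮ ⊓ LinearMap.ker (A ∘ₗ A - μ • LinearMap.id))
      (fun h => hv₀ (by
        have : v₀ ∈ Uᗮ ⊓ LinearMap.ker (A ∘ₗ A - μ • LinearMap.id) :=
          ⟨hv₀W, by simpa [sub_eq_zero] using hv₀μ⟩
        rw [h] at this
        simpa using this))
      (fun w hw => ⟨BW _ hw.1, by
        have h2 := hw.2
        simp only [LinearMap.mem_ker, LinearMap.sub_apply, LinearMap.comp_apply,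
          LinearMap.smul_apply, LinearMap.id_apply, sub_eq_zero, SetLike.mem_coe] at h2 ⊢
        rw [hAB, hAB, h2, map_smul]⟩)
    have hv₁A : A (A v₁) = μ • v₁ := by
      have := hv₁W.2
      simpa [sub_eq_zero] using this
    have hn : ‖v₁‖ ≠ 0 := by simpa using hv₁
    obtain ⟨v, hv⟩ : ∃ v, v = ‖v₁‖⁻¹ • v₁ := ⟨_, rfl⟩
    have hvW : v ∈ Uᗮ := hv ▸ Submodule.smul_mem _ _ hv₁W.1
    have hvn : inner ℝ v v = (1:ℝ) := by
      rw [hv, inner_smul_left, inner_smul_right, real_inner_self_eq_norm_sq]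
      simp; field_simp
    have hvA : A (A v) = μ • v := by rw [hv, map_smul, map_smul, hv₁A, smul_comm]
    have hvB : B v = β • v := by rw [hv, map_smul, hv₁β, smul_comm]
    have hAv : A v ≠ 0 := fun h => by
      have := hAinj _ h
      rw [this] at hvn
      simp at hvn
    obtain ⟨α, hα⟩ : ∃ α, α = ‖A v‖ := ⟨_, rfl⟩
    have hαpos : 0 < α := by rw [hα]; exact norm_pos_iff.mpr hAv
    have hAA : inner ℝ (A v) (A v) = α ^ 2 := by rw [real_inner_self_eq_norm_sq, hα]
    have hμ : μ = - α ^ 2 := by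
      have h1 := hA' v (A v)
      rw [hvA, inner_smul_right, hvn, hAA] at h1
      linarith
    have hvAv : inner ℝ (A v) v = (0:ℝ) := by
      have h1 := hA v v
      rw [real_inner_comm v (A v)] at h1
      have h2 := real_inner_comm v (A v)
      linarith
    obtain ⟨u, hu⟩ : ∃ u, u = α⁻¹ • A v := ⟨_, rfl⟩
    have huW : u ∈ Uᗮ := hu ▸ Submodule.smul_mem _ _ (AW _ hvW)
    have huu : inner ℝ u u = (1:ℝ) := by
      rw [hu, inner_smul_left, inner_smul_right, hAA]
      simp; field_simp
    have huv : inner ℝ u v = (0:ℝ) := by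
      rw [hu, inner_smul_left, hvAv, mul_zero]
    have hAu : A u = -α • v := by
      rw [hu, map_smul, hvA, hμ, smul_smul]
      congr 1
      field_simp
    have hAv' : A v = α • u := by
      rw [hu, smul_smul, mul_inv_cancel₀ hαpos.ne', one_smul]
    have hBu : B u = β • u := by
      rw [hu, map_smul, ← hAB, hvB, map_smul, smul_comm]
    rw [memW] at huW hvW
    have huW1 : ∀ j, inner ℝ u (e j) = (0:ℝ) := fun j => by rw [real_inner_comm]; exact huW.1 j
    have huW2 : ∀ j, inner ℝ u (f j) = (0:ℝ) := fun j => by rw [real_inner_comm]; exact huW.2 j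
    have hvW2 : ∀ j, inner ℝ v (f j) = (0:ℝ) := fun j => by rw [real_inner_comm]; exact hvW.2 j
    refine ⟨Fin.cons u e, Fin.cons v f, Fin.cons α a, Fin.cons β b, ?_, ?_, ?_, ?_, ?_, ?_, ?_, ?_⟩
    · intro j; refine Fin.cases ?_ (fun j => ?_) j <;> simp [hαpos, ha]
    · intro i j
      refine Fin.cases ?_ (fun i => ?_) i <;> refine Fin.cases ?_ (fun j => ?_) j
      · simp only [Fin.cons_zero, huu, if_true]
      · simp [huW1, (Fin.succ_ne_zero j).symm]
      · simp [huW.1]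
      · simp [hee]
    · intro i j
      refine Fin.cases ?_ (fun i => ?_) i <;> refine Fin.cases ?_ (fun j => ?_) j
      · simp only [Fin.cons_zero, hvn, if_true]
      · simp [hvW2, (Fin.succ_ne_zero j).symm]
      · simp [hvW.2]
      · simp [hff]
    · intro i j
      refine Fin.cases ?_ (fun i => ?_) i <;> refine Fin.cases ?_ (fun j => ?_) j
      · simp only [Fin.cons_zero, huv]
      · simp [huW2]
      · simp [hvW.1]
      · simp [hef]
    · intro j; refine Fin.cases ?_ (fun j => ?_) j
      · simpa only [Fin.cons_zero] using hAu
      · simpa only [Fin.cons_succ] using hAe j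
    · intro j; refine Fin.cases ?_ (fun j => ?_) j
      · simpa only [Fin.cons_zero] using hAv'
      · simpa only [Fin.cons_succ] using hAf j
    · intro j; refine Fin.cases ?_ (fun j => ?_) j
      · simpa only [Fin.cons_zero] using hBu
      · simpa only [Fin.cons_succ] using hBe j
    · intro j; refine Fin.cases ?_ (fun j => ?_) j
      · simpa only [Fin.cons_zero] using hvB
      · simpa only [Fin.cons_succ] using hBf j

end helpers

lemma matrix_normal_form (n : ℕ) (A B : Matrix (Fin 2 × Fin n) (Fin 2 × Fin n) ℝ)
    (hA : Aᵀ = -A) (hAinj : ∀ x, A *ᵥ x = 0 → x = 0) (hB : Bᵀ = B) (hAB : A * B = B * A) :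
    ∃ (O : Matrix (Fin 2 × Fin n) (Fin 2 × Fin n) ℝ) (a b : Fin n → ℝ), (∀ j, 0 < a j) ∧
      O * Oᵀ = 1 ∧ O * A * Oᵀ = Matrix.blockDiagonal (fun j => a j • Omega1) ∧
      O * B * Oᵀ = Matrix.blockDiagonal (fun j => b j • (1 : Matrix (Fin 2) (Fin 2) ℝ)) := by
  have key : ∀ (C : Matrix (Fin 2 × Fin n) (Fin 2 × Fin n) ℝ)
      (x y : EuclideanSpace ℝ (Fin 2 × Fin n)),
      inner ℝ (Matrix.toEuclideanLin C x) y = inner ℝ x (Matrix.toEuclideanLin Cᵀ y) := by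
    intro C x y
    simp only [EuclideanSpace.inner_eq_star_dotProduct, Matrix.ofLp_toEuclideanLin_apply,
      star_trivial]
    rw [Matrix.dotProduct_mulVec, ← Matrix.mulVec_transpose]
  obtain ⟨e, f, a, b, ha, hee, hff, hef, hAe, hAf, hBe, hBf⟩ := exists_family
    (Matrix.toEuclideanLin A) (Matrix.toEuclideanLin B)
    (fun x y => by rw [key, hA]; simp)
    (fun x hx => by
      have := hAinj x.ofLp (by
        have := congrArg WithLp.ofLp hx
        simpa [Matrix.ofLp_toEuclideanLin_apply] using this)
      ext i
      simpa using congrFun this i)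
    (fun x y => by rw [key, hB])
    (fun x => by
      ext i
      simp only [Matrix.ofLp_toEuclideanLin_apply, Matrix.mulVec_mulVec, hAB]) n
    (by simp)
  have hfe : ∀ i j, inner ℝ (f i) (e j) = (0:ℝ) := fun i j => by
    rw [real_inner_comm]; exact hef j i
  have hee1 : ∀ j, ‖e j‖ = 1 := fun j => by
    rw [norm_eq_sqrt_real_inner, hee]; simp
  have hff1 : ∀ j, ‖f j‖ = 1 := fun j => by
    rw [norm_eq_sqrt_real_inner, hff]; simp
  let g : Fin 2 × Fin n → EuclideanSpace ℝ (Fin 2 × Fin n) := fun p =>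
    if p.1 = 0 then e p.2 else f p.2
  let O : Matrix (Fin 2 × Fin n) (Fin 2 × Fin n) ℝ := Matrix.of fun p q => g p q
  have entry : ∀ (C : Matrix (Fin 2 × Fin n) (Fin 2 × Fin n) ℝ) p q,
      (O * C * Oᵀ) p q = inner ℝ (g p) (Matrix.toEuclideanLin C (g q)) := by
    intro C p q
    simp only [EuclideanSpace.inner_eq_star_dotProduct, Matrix.ofLp_toEuclideanLin_apply,
      star_trivial]
    rw [Matrix.mul_assoc, dotProduct_comm]
    rfl
  refine ⟨O, a, b, ha, ?_, ?_, ?_⟩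
  · ext ⟨i, j⟩ ⟨i', j'⟩
    have := entry 1 (i, j) (i', j')
    rw [Matrix.mul_one] at this
    rw [this]
    have h1 : Matrix.toEuclideanLin (1 : Matrix (Fin 2 × Fin n) (Fin 2 × Fin n) ℝ) (g (i', j'))
        = g (i', j') := by ext; simp [Matrix.ofLp_toEuclideanLin_apply]
    rw [h1]
    fin_cases i <;> fin_cases i' <;> simp [g, hee, hff, hef, hfe, Matrix.one_apply]
  · ext ⟨i, j⟩ ⟨i', j'⟩
    rw [entry, Matrix.blockDiagonal_apply]
    by_cases h : j = j'
    · subst h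
      fin_cases i <;> fin_cases i' <;>
        simp [g, hAe, hAf, inner_smul_right, hee, hff, hef, hfe, Omega1, hee1, hff1]
    · fin_cases i <;> fin_cases i' <;>
        simp [g, hAe, hAf, inner_smul_right, hee, hff, hef, hfe, Omega1, h]
  · ext ⟨i, j⟩ ⟨i', j'⟩
    rw [entry, Matrix.blockDiagonal_apply]
    by_cases h : j = j'
    · subst h
      fin_cases i <;> fin_cases i' <;>
        simp [g, hBe, hBf, inner_smul_right, hee, hff, hef, hfe, hee1, hff1]
    · fin_cases i <;> fin_cases i' <;>
        simp [g, hBe, hBf, inner_smul_right, hee, hff, hef, hfe, h]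

lemma Omega1_sq : Omega1 * Omega1 = -1 := by
  ext i j; fin_cases i <;> fin_cases j <;> simp [Omega1]

lemma OmegaN_sq (n : ℕ) : OmegaN n * OmegaN n = -1 := by
  rw [OmegaN, ← Matrix.blockDiagonal_mul, Omega1_sq]
  rw [← Matrix.blockDiagonal_one, ← Matrix.blockDiagonal_neg]
  rfl

lemma OmegaN_transpose (n : ℕ) : (OmegaN n)ᵀ = -OmegaN n := by
  rw [OmegaN, Matrix.blockDiagonal_transpose, ← Matrix.blockDiagonal_neg]
  congr 1
  funext k
  ext i j; fin_cases i <;> fin_cases j <;> simp [Omega1]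

/-- Extension of Williamson's theorem (Theorem 5.4): for real symmetric `M`, `Q` with `M`
positive definite and `Q` commuting with `Ω_n`, simultaneous normal mode decomposition
by a symplectic congruence is possible iff `Ω_n M` and `Ω_n Q` commute. -/
theorem williamson_extension (n : ℕ)
    (M Q : Matrix (Fin 2 × Fin n) (Fin 2 × Fin n) ℝ)
    (hMsymm : M.IsSymm) (hMpd : M.PosDef) (hQsymm : Q.IsSymm)
    (hQOmega : Q * OmegaN n = OmegaN n * Q) :
    (∃ S : Matrix (Fin 2 × Fin n) (Fin 2 × Fin n) ℝ, IsSymplectic S ∧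
      ∃ ν q : Fin n → ℝ, (∀ j, 0 ≤ ν j) ∧
        S * M * Sᵀ = Matrix.blockDiagonal (fun j => (ν j) • (1 : Matrix (Fin 2) (Fin 2) ℝ)) ∧
        S * Q * Sᵀ = Matrix.blockDiagonal (fun j => (q j) • (1 : Matrix (Fin 2) (Fin 2) ℝ))) ↔
    (OmegaN n * M) * (OmegaN n * Q) = (OmegaN n * Q) * (OmegaN n * M) := by
  have hJJ := OmegaN_sq n
  have hJT := OmegaN_transpose n
  constructor
  · rintro ⟨S, hS, ν, q, -, hM, hQ⟩
    unfold IsSymplectic at hS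
    set J := OmegaN n with hJ
    -- right inverse of S
    have hR : S * (-(J * Sᵀ * J)) = 1 := by
      have : S * (-(J * Sᵀ * J)) = -((S * J * Sᵀ) * J) := by noncomm_ring
      rw [this, hS, hJJ, neg_neg]
    have hL : (-(J * Sᵀ * J)) * S = 1 := mul_eq_one_comm.mp hR
    have hT : Sᵀ * (J * S * -J) = 1 := by
      have := congrArg Matrix.transpose hR
      rw [Matrix.transpose_mul, Matrix.transpose_one] at this
      simp only [Matrix.transpose_neg, Matrix.transpose_mul, Matrix.transpose_transpose, hJT]
        at this
      have h2 : Sᵀ * (J * S * -J) = -(-J * (S * -J)) * Sᵀ := by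
        rw [this]
        apply mul_eq_one_comm.mp
        rw [← this]
        noncomm_ring
      rw [h2, this]
    set D := Matrix.blockDiagonal (fun j => (ν j) • (1 : Matrix (Fin 2) (Fin 2) ℝ)) with hD
    set E := Matrix.blockDiagonal (fun j => (q j) • (1 : Matrix (Fin 2) (Fin 2) ℝ)) with hE
    have hcomm : D * J * E = E * J * D := by
      rw [hD, hE, hJ, OmegaN]
      simp only [← Matrix.blockDiagonal_mul]
      congr 1
      funext j
      simp [smul_smul, mul_comm]
    have h3 : S * (M * J * Q) * Sᵀ = S * (Q * J * M) * Sᵀ := by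
      have hSJS : Sᵀ * J * S = J := by
        have : J * (Sᵀ * J * S) = J * J := by
          rw [hJJ, ← neg_eq_iff_eq_neg, ← hL]; noncomm_ring
        have h5 := congrArg (fun X => J * X) this
        simp only [← Matrix.mul_assoc, hJJ] at h5
        simpa [Matrix.mul_assoc] using h5
      have e1 : ∀ X Y : Matrix (Fin 2 × Fin n) (Fin 2 × Fin n) ℝ,
          S * (X * J * Y) * Sᵀ = (S * X * Sᵀ) * J * (S * Y * Sᵀ) := by
        intro X Y
        conv_lhs => rw [← hSJS]
        noncomm_ring
      rw [e1, e1, hM, hQ, hcomm]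
    have h4 : M * J * Q = Q * J * M := by
      have e2 : ∀ X : Matrix (Fin 2 × Fin n) (Fin 2 × Fin n) ℝ,
          X = (-(J * Sᵀ * J)) * (S * X * Sᵀ) * (J * S * -J) := by
        intro X
        calc X = 1 * X * 1 := by simp
          _ = ((-(J * Sᵀ * J)) * S) * X * (Sᵀ * (J * S * -J)) := by rw [hL, hT]
          _ = _ := by noncomm_ring
      rw [e2 (M * J * Q), h3, ← e2]
    calc (J * M) * (J * Q) = J * (M * J * Q) := by noncomm_ring
      _ = J * (Q * J * M) := by rw [h4]
      _ = _ := by noncomm_ring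
  · intro h
    obtain ⟨y, z, hM, hyz, hzy⟩ := posDef_factor M hMpd
    set J := OmegaN n with hJ
    have hzyT : zᵀ * yᵀ = 1 := by rw [← Matrix.transpose_mul, hyz, Matrix.transpose_one]
    have hyzT : yᵀ * zᵀ = 1 := by rw [← Matrix.transpose_mul, hzy, Matrix.transpose_one]
    obtain ⟨N, hN⟩ : ∃ N, N = z * zᵀ := ⟨_, rfl⟩
    have hMN : M * N = 1 := by
      rw [hM, hN]
      calc yᵀ * y * (z * zᵀ) = yᵀ * (y * z) * zᵀ := by noncomm_ring
        _ = 1 := by rw [hyz, Matrix.mul_one, hyzT]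
    have hNM : N * M = 1 := mul_eq_one_comm.mp hMN
    have hcom : M * J * Q = Q * J * M := by
      have e : ∀ X Y : Matrix (Fin 2 × Fin n) (Fin 2 × Fin n) ℝ,
          X * J * Y = -(J * ((J * X) * (J * Y))) := by
        intro X Y
        calc X * J * Y = -(-1 * (X * J * Y)) := by simp
          _ = -((J * J) * (X * J * Y)) := by rw [hJJ]
          _ = _ := by noncomm_ring
      rw [e, h, ← e]
    have h1 : J * Q * N = N * Q * J := by
      calc J * Q * N = (N * M) * J * Q * N := by rw [hNM, Matrix.one_mul]
        _ = N * (M * J * Q) * N := by noncomm_ring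
        _ = N * (Q * J) * (M * N) := by rw [hcom]; noncomm_ring
        _ = _ := by rw [hMN]; noncomm_ring
    have h2 : J * N * Q = Q * N * J := by
      have : J * (J * Q * N) * J = J * (N * Q * J) * J := by rw [h1]
      have l : J * (J * Q * N) * J = -(Q * N * J) := by
        calc J * (J * Q * N) * J = (J * J) * Q * N * J := by noncomm_ring
          _ = _ := by rw [hJJ]; noncomm_ring
      have r : J * (N * Q * J) * J = -(J * N * Q) := by
        calc J * (N * Q * J) * J = J * N * Q * (J * J) := by noncomm_ring
          _ = _ := by rw [hJJ]; noncomm_ring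
      rw [l, r] at this
      exact (neg_injective this).symm
    obtain ⟨O, a, b, ha, hO, hOA, hOB⟩ := matrix_normal_form n (zᵀ * J * z) (zᵀ * Q * z)
      (by simp [Matrix.transpose_mul, hJT, Matrix.mul_assoc])
      (by
        intro x hx
        have : (-(y * J * yᵀ)) * (zᵀ * J * z) = 1 := by
          calc (-(y * J * yᵀ)) * (zᵀ * J * z) = -(y * J * (yᵀ * zᵀ) * J * z) := by noncomm_ring
            _ = -(y * (J * J) * z) := by rw [hyzT]; noncomm_ring
            _ = y * z := by rw [hJJ]; noncomm_ring
            _ = 1 := hyz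
        rw [← Matrix.one_mulVec x, ← this, ← Matrix.mulVec_mulVec, hx, Matrix.mulVec_zero])
      (by simp [Matrix.transpose_mul, hQsymm.eq, Matrix.mul_assoc])
      (by
        calc zᵀ * J * z * (zᵀ * Q * z) = zᵀ * (J * (z * zᵀ) * Q) * z := by noncomm_ring
          _ = zᵀ * (Q * (z * zᵀ) * J) * z := by rw [← hN, h2]
          _ = _ := by noncomm_ring)
    obtain ⟨D, hD⟩ : ∃ D, D = Matrix.blockDiagonal
      (fun j => (Real.sqrt (a j))⁻¹ • (1 : Matrix (Fin 2) (Fin 2) ℝ)) := ⟨_, rfl⟩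
    have hDT : Dᵀ = D := by
      rw [hD, Matrix.blockDiagonal_transpose]; simp
    have hsq : ∀ j, (Real.sqrt (a j))⁻¹ * (Real.sqrt (a j))⁻¹ = (a j)⁻¹ := fun j => by
      rw [← mul_inv, Real.mul_self_sqrt (ha j).le]
    have eS : ∀ X, (D * O * zᵀ) * X * (D * O * zᵀ)ᵀ = D * (O * (zᵀ * X * z) * Oᵀ) * D := by
      intro X
      simp only [Matrix.transpose_mul, Matrix.transpose_transpose, hDT, Matrix.mul_assoc]
    refine ⟨D * O * zᵀ, ?_, fun j => (a j)⁻¹, fun j => (a j)⁻¹ * b j,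
      fun j => (inv_pos.mpr (ha j)).le, ?_, ?_⟩
    · unfold IsSymplectic
      rw [← hJ, eS, hOA, hD, hJ, OmegaN]
      simp only [← Matrix.blockDiagonal_mul]
      congr 1
      funext j
      simp only [Matrix.smul_mul, Matrix.mul_smul, Matrix.one_mul, Matrix.mul_one, smul_smul]
      have h6 := hsq j
      have : (Real.sqrt (a j))⁻¹ * ((Real.sqrt (a j))⁻¹ * a j) = 1 := by
        rw [← mul_assoc, h6, inv_mul_cancel₀ (ha j).ne']
      first
        | rw [this, one_smul]
        | (rw [mul_comm (a j), this, one_smul])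
        | (rw [mul_assoc, mul_comm (a j), this, one_smul])
    · have : zᵀ * M * z = 1 := by
        calc zᵀ * M * z = (zᵀ * yᵀ) * (y * z) := by rw [hM]; noncomm_ring
          _ = 1 := by rw [hzyT, hyz, Matrix.one_mul]
      rw [eS, this, Matrix.mul_one, hO, Matrix.mul_one, hD]
      simp only [← Matrix.blockDiagonal_mul]
      congr 1
      funext j
      simp only [Matrix.smul_mul, Matrix.mul_smul, Matrix.one_mul, smul_smul, hsq]
    · rw [eS, hOB, hD]
      simp only [← Matrix.blockDiagonal_mul]
      congr 1
      funext j
      simp only [Matrix.smul_mul, Matrix.mul_smul, Matrix.one_mul, smul_smul]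
      congr 1
      rw [← hsq]; ring
end
end

section
/- Lemma E.2 (simultaneous canonical form of commuting antisymmetric matrices): Let A_1,…,A_N be (2n×2n) real antisymmetric matrices that pairwise commute. Then there exists a single (2n×2n) real orthogonal matrix O and reals a_{j,k} (for j = 1,…,N and k = 1,…,n, possibly zero) such that O * A_j * Oᵀ = blockdiag(a_{j,k}·Ω₁) for every j. -/
open Matrix

noncomputable section

open scoped InnerProductSpace in
lemma exists_pair {N : ℕ} {E : Type} [NormedAddCommGroup E] [InnerProductSpace ℝ E]
    [FiniteDimensional ℝ E] (hd : 2 ≤ Module.finrank ℝ E) (T : Fin N → E →ₗ[ℝ] E)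
    (hs : ∀ j x y, ⟪T j x, y⟫_ℝ = -⟪x, T j y⟫_ℝ)
    (hc : ∀ j k x, T j (T k x) = T k (T j x)) :
    ∃ u v : E, ⟪u, u⟫_ℝ = 1 ∧ ⟪v, v⟫_ℝ = 1 ∧ ⟪u, v⟫_ℝ = 0 ∧
      ∃ a : Fin N → ℝ, ∀ j, T j v = a j • u ∧ T j u = -(a j • v) := by
  by_cases h0 : ∀ j x, T j x = 0
  · let b := stdOrthonormalBasis ℝ E
    have hb := orthonormal_iff_ite.1 b.orthonormal
    refine ⟨b ⟨0, by omega⟩, b ⟨1, by omega⟩, ?_, ?_, ?_, fun _ => 0, ?_⟩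
    · rw [hb]; simp
    · rw [hb]; simp
    · rw [hb]; simp
    · intro j; simp [h0]
  push Not at h0
  obtain ⟨i, z, hz⟩ := h0
  let S : Fin N × Fin N → E →ₗ[ℝ] E := fun p => T p.1 ∘ₗ T p.2
  have htop := LinearMap.IsSymmetric.iSup_iInf_eq_top_of_commute (T := S)
    (by
      intro p x y
      simp only [S, LinearMap.comp_apply]
      rw [hs, hs, hc]; simp)
    (by
      intro p q _
      refine LinearMap.ext fun x => ?_
      simp only [S, Module.End.mul_apply, LinearMap.comp_apply]
      rw [hc p.2 q.1, hc p.1 q.1, hc p.2 q.2, hc p.1 q.2])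
  have hex : ∃ x : E, ∃ χ : Fin N × Fin N → ℝ, (∀ p, S p x = χ p • x) ∧ T i x ≠ 0 := by
    by_contra hcon
    push Not at hcon
    have : (⊤ : Submodule ℝ E) ≤ LinearMap.ker (T i) := by
      rw [← htop]
      refine iSup_le fun χ x hx => ?_
      rw [Submodule.mem_iInf] at hx
      exact hcon x χ fun p => Module.End.mem_eigenspace_iff.1 (hx p)
    exact hz (this (Submodule.mem_top (x := z)))
  obtain ⟨x, χ, hx, hy⟩ := hex
  have hxx : ∀ j k, T j (T k x) = χ (j, k) • x := fun j k => hx (j, k)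
  have hx0 : x ≠ 0 := by rintro rfl; simp at hy
  have hself : ⟪x, T i x⟫_ℝ = 0 := by
    have := hs i x x
    rw [real_inner_comm] at this; linarith
  have hχ : χ (i, i) ≠ 0 := by
    intro h
    have h1 := hs i x (T i x)
    rw [hxx i i, h] at h1
    simp at h1
    exact hy h1
  have hTx : ∀ j, T j x = (χ (i, j) / χ (i, i)) • T i x := by
    intro j
    have h1 : T i (T i (T j x)) = χ (i, i) • T j x := by
      rw [hc i j x, hc i j, hxx i i, map_smul]
    rw [hxx i j, map_smul] at h1
    rw [div_eq_inv_mul, mul_smul, h1, smul_smul, inv_mul_cancel₀ hχ, one_smul]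
  have nx : ‖x‖ ≠ 0 := norm_ne_zero_iff.2 hx0
  have ny : ‖T i x‖ ≠ 0 := norm_ne_zero_iff.2 hy
  obtain ⟨u, hu⟩ : ∃ u, u = ‖x‖⁻¹ • x := ⟨_, rfl⟩
  obtain ⟨v, hv⟩ : ∃ v, v = ‖T i x‖⁻¹ • T i x := ⟨_, rfl⟩
  have hu' : x = ‖x‖ • u := by rw [hu, smul_smul, mul_inv_cancel₀ nx, one_smul]
  have hv' : T i x = ‖T i x‖ • v := by rw [hv, smul_smul, mul_inv_cancel₀ ny, one_smul]
  have huu : ⟪u, u⟫_ℝ = 1 := by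
    rw [hu, real_inner_smul_left, real_inner_smul_right, real_inner_self_eq_norm_sq]; field_simp
  have hvv : ⟪v, v⟫_ℝ = 1 := by
    rw [hv, real_inner_smul_left, real_inner_smul_right, real_inner_self_eq_norm_sq]; field_simp
  have huv : ⟪u, v⟫_ℝ = 0 := by
    rw [hu, hv, real_inner_smul_left, real_inner_smul_right, hself]; simp
  refine ⟨u, v, huu, hvv, huv, fun j => ‖T i x‖⁻¹ * (χ (j, i) * ‖x‖), fun j => ?_⟩
  have e1 : T j v = (‖T i x‖⁻¹ * (χ (j, i) * ‖x‖)) • u := by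
    rw [mul_smul, mul_smul, ← hu', ← hxx j i, hv, map_smul]
  have e2 : T j u = (‖x‖⁻¹ * ((χ (i, j) / χ (i, i)) * ‖T i x‖)) • v := by
    rw [mul_smul, mul_smul, ← hv', ← hTx j, hu, map_smul]
  refine ⟨e1, ?_⟩
  have := hs j u v
  rw [e1, e2, real_inner_smul_left, real_inner_smul_right, huu, hvv, mul_one, mul_one] at this
  rw [e2, this, neg_smul]

open scoped InnerProductSpace in
lemma exists_family_s2 {N : ℕ} (n : ℕ) : ∀ (E : Type) [NormedAddCommGroup E] [InnerProductSpace ℝ E]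
    [FiniteDimensional ℝ E] (_ : Module.finrank ℝ E = 2 * n) (T : Fin N → E →ₗ[ℝ] E)
    (_ : ∀ j x y, ⟪T j x, y⟫_ℝ = -⟪x, T j y⟫_ℝ)
    (_ : ∀ j k x, T j (T k x) = T k (T j x)),
    ∃ u v : Fin n → E, (∀ k l, ⟪u k, u l⟫_ℝ = if k = l then 1 else 0) ∧
      (∀ k l, ⟪v k, v l⟫_ℝ = if k = l then 1 else 0) ∧ (∀ k l, ⟪u k, v l⟫_ℝ = 0) ∧
      ∃ a : Fin N → Fin n → ℝ, ∀ j k, T j (v k) = a j k • u k ∧ T j (u k) = -(a j k • v k) := by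
  induction n with
  | zero =>
    intro E _ _ _ _ T _ _
    exact ⟨fun _ => 0, fun _ => 0, fun k => k.elim0, fun k => k.elim0, fun k => k.elim0,
      fun _ _ => 0, fun _ k => k.elim0⟩
  | succ n ih =>
    intro E _ _ _ hd T hs hc
    obtain ⟨u, v, huu, hvv, huv, a, ha⟩ := exists_pair (by omega) T hs hc
    have hvu : ⟪v, u⟫_ℝ = 0 := by rw [real_inner_comm]; exact huv
    let K : Submodule ℝ E := Submodule.span ℝ (Set.range ![u, v])
    have hK : Module.finrank ℝ K = 2 := by
      have ho : Orthonormal ℝ ![u, v] := by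
        rw [orthonormal_iff_ite]
        intro i j
        fin_cases i <;> fin_cases j
        · simpa using huu
        · simpa using huv
        · simpa using hvu
        · simpa using hvv
      simpa using finrank_span_eq_card ho.linearIndependent
    have hW : Module.finrank ℝ Kᗮ = 2 * n := by
      have := K.finrank_add_finrank_orthogonal
      omega
    have memW : ∀ x, x ∈ Kᗮ ↔ ⟪u, x⟫_ℝ = 0 ∧ ⟪v, x⟫_ℝ = 0 := by
      intro x
      constructor
      · intro hx
        exact ⟨(Submodule.mem_orthogonal K x).1 hx u (Submodule.subset_span ⟨0, rfl⟩),
          (Submodule.mem_orthogonal K x).1 hx v (Submodule.subset_span ⟨1, rfl⟩)⟩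
      · rintro ⟨h1, h2⟩
        rw [Submodule.mem_orthogonal]
        intro w hw
        induction hw using Submodule.span_induction with
        | mem y hy =>
          obtain ⟨i, rfl⟩ := hy
          fin_cases i
          · exact h1
          · exact h2
        | zero => simp
        | add y z _ _ h3 h4 => rw [inner_add_left, h3, h4, add_zero]
        | smul c y _ h3 => rw [real_inner_smul_left, h3, mul_zero]
    have hinv : ∀ j, ∀ x ∈ Kᗮ, T j x ∈ Kᗮ := by
      intro j x hx
      rw [memW] at hx ⊢
      have h1 := hs j u x
      have h2 := hs j v x
      rw [(ha j).2, inner_neg_left, real_inner_smul_left, hx.2] at h1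
      rw [(ha j).1, real_inner_smul_left, hx.1] at h2
      constructor <;> linarith
    obtain ⟨U, V, hU, hV, hUV, b, hb⟩ := ih Kᗮ hW (fun j => (T j).restrict (hinv j))
      (fun j x y => hs j x y) (fun j k x => Subtype.ext (hc j k x))
    have hU1 : ∀ k, ⟪u, (U k : E)⟫_ℝ = 0 := fun k => ((memW _).1 (U k).2).1
    have hU2 : ∀ k, ⟪v, (U k : E)⟫_ℝ = 0 := fun k => ((memW _).1 (U k).2).2
    have hV1 : ∀ k, ⟪u, (V k : E)⟫_ℝ = 0 := fun k => ((memW _).1 (V k).2).1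
    have hV2 : ∀ k, ⟪v, (V k : E)⟫_ℝ = 0 := fun k => ((memW _).1 (V k).2).2
    refine ⟨Fin.cons u (fun k => (U k : E)), Fin.cons v (fun k => (V k : E)), ?_, ?_, ?_,
      fun j => Fin.cons (a j) (b j), ?_⟩
    · intro k l
      refine Fin.cases ?_ (fun k => ?_) k <;> refine Fin.cases ?_ (fun l => ?_) l
      · simpa using huu
      · simpa [(Fin.succ_ne_zero l).symm] using hU1 l
      · rw [real_inner_comm]; simpa [Fin.succ_ne_zero] using hU1 k
      · simpa using hU k l
    · intro k l
      refine Fin.cases ?_ (fun k => ?_) k <;> refine Fin.cases ?_ (fun l => ?_) l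
      · simpa using hvv
      · simpa [(Fin.succ_ne_zero l).symm] using hV2 l
      · rw [real_inner_comm]; simpa [Fin.succ_ne_zero] using hV2 k
      · simpa using hV k l
    · intro k l
      refine Fin.cases ?_ (fun k => ?_) k <;> refine Fin.cases ?_ (fun l => ?_) l
      · simpa using huv
      · simpa using hV1 l
      · rw [real_inner_comm]; simpa using hU2 k
      · simpa using hUV k l
    · intro j k
      refine Fin.cases ?_ (fun k => ?_) k
      · simpa using ha j
      · exact ⟨congrArg Subtype.val (hb j k).1, congrArg Subtype.val (hb j k).2⟩

/-- Lemma E.2: pairwise commuting real antisymmetric matrices can be simultaneously brought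
to the canonical block form `blockdiag(a_{j,k} · Ω₁)` by a single orthogonal matrix. -/
theorem lemmaE2 (n N : ℕ) (A : Fin N → Matrix (Fin 2 × Fin n) (Fin 2 × Fin n) ℝ)
    (hanti : ∀ j, (A j)ᵀ = -(A j))
    (hcomm : ∀ j k, A j * A k = A k * A j) :
    ∃ O : Matrix (Fin 2 × Fin n) (Fin 2 × Fin n) ℝ, O * Oᵀ = 1 ∧
      ∃ a : Fin N → Fin n → ℝ,
        ∀ j, O * A j * Oᵀ = Matrix.blockDiagonal (fun k => (a j k) • Omega1) := by
  have hin : ∀ x y : EuclideanSpace ℝ (Fin 2 × Fin n), inner ℝ x y = x.ofLp ⬝ᵥ y.ofLp := by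
    intro x y
    rw [EuclideanSpace.inner_eq_star_dotProduct, dotProduct_comm]; simp
  obtain ⟨u, v, hu, hv, huv, a, ha⟩ := exists_family_s2 (N := N) n
    (EuclideanSpace ℝ (Fin 2 × Fin n)) (by simp)
    (fun j => Matrix.toEuclideanLin (A j))
    (by
      intro j x y
      simp only [hin, Matrix.toLpLin_apply]
      rw [dotProduct_mulVec, ← mulVec_transpose, hanti, neg_mulVec, neg_dotProduct, neg_neg])
    (by
      intro j k x
      simp only [Matrix.toLpLin_apply, mulVec_mulVec, hcomm j k])
  simp only [hin] at hu hv huv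
  have hvu : ∀ k l, (v k).ofLp ⬝ᵥ (u l).ofLp = 0 := fun k l => by
    rw [dotProduct_comm]; exact huv l k
  have ha1 : ∀ j k, A j *ᵥ (v k).ofLp = a j k • (u k).ofLp := fun j k =>
    congrArg WithLp.ofLp (ha j k).1
  have ha2 : ∀ j k, A j *ᵥ (u k).ofLp = -(a j k • (v k).ofLp) := fun j k =>
    congrArg WithLp.ofLp (ha j k).2
  let O : Matrix (Fin 2 × Fin n) (Fin 2 × Fin n) ℝ :=
    Matrix.of fun p => (![u p.2, v p.2] p.1).ofLp
  have hO : ∀ (M : Matrix (Fin 2 × Fin n) (Fin 2 × Fin n) ℝ) p q,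
      (O * M * Oᵀ) p q = (![u p.2, v p.2] p.1).ofLp ⬝ᵥ (M *ᵥ (![u q.2, v q.2] q.1).ofLp) := by
    intro M p q
    rw [Matrix.mul_assoc]
    rfl
  refine ⟨O, ?_, a, fun j => ?_⟩
  · ext ⟨i, k⟩ ⟨i', l⟩
    have h1 := hO 1 (i, k) (i', l)
    rw [Matrix.mul_one, one_mulVec] at h1
    rw [h1]
    fin_cases i <;> fin_cases i' <;> simp [hu, hv, huv, hvu, Matrix.one_apply]
  · ext ⟨i, k⟩ ⟨i', l⟩
    rw [hO, Matrix.blockDiagonal_apply]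
    fin_cases i <;> fin_cases i' <;>
      simp [hu, hv, huv, hvu, ha1, ha2, Omega1] <;>
      · by_cases h : k = l <;> simp [h]
end
end

section
/- Theorem 5.3 (complete set of conservation laws for incoherent Gaussian states): Let Q be a (2n×2n) real symmetric matrix commuting with Ω_n, with spectral projectors Π_q for q ∈ ℝ. Let σ₁ and σ₂ be (2n×2n) real symmetric positive-definite matrices, each commuting with Ω_n * Q. Then there exists a symplectic matrix S with S * Q * Sᵀ = Q and S * σ₁ * Sᵀ = σ₂ if and only if both of the following hold: (a) for every natural number k, trace((σ₁ * Ω_n * Π₀)^k) = trace((σ₂ * Ω_n * Π₀)^k); and (b) for every real q > 0 and every natural number k, trace((σ₁ * (Π_q − Π_{−q}))^k) = trace((σ₂ * (Π_q − Π_{−q}))^k). -/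
open Matrix

noncomputable section

lemma powsum_multiset {ι : Type*} [Fintype ι] (f g : ι → ℝ)
    (h : ∀ k : ℕ, ∑ i, f i ^ k = ∑ i, g i ^ k) :
    Multiset.map f Finset.univ.val = Multiset.map g Finset.univ.val := by
  classical
  have hp : ∀ p : Polynomial ℝ, ∑ i, p.eval (f i) = ∑ i, p.eval (g i) := by
    intro p
    induction p using Polynomial.induction_on' with
    | add p q hp hq => simp [Finset.sum_add_distrib, hp, hq]
    | monomial k a => simp [← Finset.mul_sum, h]
  ext c
  set s : Finset ℝ := Finset.univ.image f ∪ Finset.univ.image g with hs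
  let p := Lagrange.interpolate s id (fun x => if x = c then (1:ℝ) else 0)
  have hev : ∀ x ∈ s, p.eval x = if x = c then 1 else 0 := fun x hx =>
    Lagrange.eval_interpolate_at_node (v := id) _ (Function.injective_id.injOn) hx
  have := hp p
  rw [Finset.sum_congr rfl (fun i _ => hev (f i) (by simp [hs])),
    Finset.sum_congr rfl (fun i _ => hev (g i) (by simp [hs]))] at this
  simp only [Finset.sum_boole, Nat.cast_inj] at this
  rw [Multiset.count_map, Multiset.count_map]
  simpa [Finset.card, Finset.filter, eq_comm] using this

lemma trace_pow_eig {ι : Type*} [Fintype ι] [DecidableEq ι] {H : Matrix ι ι ℂ}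
    (hH : H.IsHermitian) (k : ℕ) : (H ^ k).trace = ((∑ i, hH.eigenvalues i ^ k : ℝ) : ℂ) := by
  have hsp := hH.spectral_theorem
  have hp : H ^ k = Unitary.conjStarAlgAut ℂ _ hH.eigenvectorUnitary
      ((diagonal (RCLike.ofReal ∘ hH.eigenvalues)) ^ k) := by
    rw [map_pow, ← hsp]
  rw [hp, Unitary.conjStarAlgAut_apply, Matrix.trace_mul_cycle, Unitary.coe_star_mul_self, one_mul,
    Matrix.diagonal_pow, Matrix.trace_diagonal]
  simp

lemma herm_sim {ι : Type*} [Fintype ι] [DecidableEq ι] {H K : Matrix ι ι ℂ}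
    (hH : H.IsHermitian) (hK : K.IsHermitian)
    (h : ∀ k : ℕ, (H ^ k).trace = (K ^ k).trace) :
    ∃ U : Matrix ι ι ℂ, IsUnit U ∧ U * H = K * U := by
  have he : hH.eigenvalues = hK.eigenvalues := by
    rw [Matrix.IsHermitian.eigenvalues_eq_eigenvalues_iff, hH.charpoly_eq, hK.charpoly_eq]
    have := powsum_multiset hH.eigenvalues hK.eigenvalues (fun k => by
      have := h k
      rw [trace_pow_eig hH, trace_pow_eig hK] at this
      exact_mod_cast this)
    have := congrArg (fun m => (Multiset.map (fun x : ℝ => (Polynomial.X - Polynomial.C (x:ℂ))) m).prod) this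
    simpa using this
  have h1 := hH.spectral_theorem
  have h2 := hK.spectral_theorem
  rw [← he] at h2
  rw [Unitary.conjStarAlgAut_apply] at h1 h2
  set D := diagonal ((RCLike.ofReal : ℝ → ℂ) ∘ hH.eigenvalues)
  set U := hH.eigenvectorUnitary
  set V := hK.eigenvectorUnitary
  refine ⟨(V : Matrix ι ι ℂ) * star (U : Matrix ι ι ℂ), ?_, ?_⟩
  · exact (Unitary.toUnits (V * star U)).isUnit
  · rw [h1, h2]
    simp only [mul_assoc]
    rw [← mul_assoc (star (U : Matrix ι ι ℂ)) U, Unitary.coe_star_mul_self,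
      ← mul_assoc (star (V : Matrix ι ι ℂ)) V, Unitary.coe_star_mul_self]
    simp

/-- real intertwiner -/
lemma real_sim {ι : Type*} [Fintype ι] [DecidableEq ι] {C D : Matrix ι ι ℝ}
    (hC : Cᵀ = -C) (hD : Dᵀ = -D)
    (h : ∀ k : ℕ, (C ^ k).trace = (D ^ k).trace) :
    ∃ T : Matrix ι ι ℝ, IsUnit T ∧ T * C = D * T := by
  have hh : ∀ {C : Matrix ι ι ℝ}, Cᵀ = -C → (Complex.I • C.map Complex.ofRealHom).IsHermitian := by
    intro C hC
    ext i j
    have := congrFun (congrFun hC i) j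
    simp at this
    simp [this]
  have ht : ∀ (C : Matrix ι ι ℝ) (k : ℕ), ((Complex.I • C.map Complex.ofRealHom)^k).trace
      = Complex.I ^ k * ((C^k).trace : ℝ) := by
    intro C k
    rw [smul_pow, ← Matrix.map_pow, trace_smul]
    simp [Matrix.trace]
  obtain ⟨U, hU, hUC⟩ := herm_sim (hh hC) (hh hD) (fun k => by rw [ht, ht, h])
  have hUC' : U * C.map Complex.ofRealHom = D.map Complex.ofRealHom * U := by
    have : Complex.I • (U * C.map Complex.ofRealHom) = Complex.I • (D.map Complex.ofRealHom * U) := by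
      simpa using hUC
    exact smul_right_injective _ Complex.I_ne_zero this
  set X := U.map Complex.re
  set Y := U.map Complex.im
  have hX : X * C = D * X := by
    ext i j
    have := congrArg Complex.re (congrFun (congrFun hUC' i) j)
    simpa [Matrix.mul_apply, X] using this
  have hY : Y * C = D * Y := by
    ext i j
    have := congrArg Complex.im (congrFun (congrFun hUC' i) j)
    simpa [Matrix.mul_apply, Y] using this
  let p : Polynomial ℝ := (X.map Polynomial.C + (Polynomial.X : Polynomial ℝ) • Y.map Polynomial.C).det
  have hp : p ≠ 0 := by
    intro h0
    have : p.eval₂ Complex.ofRealHom Complex.I = U.det := by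
      change Polynomial.eval₂RingHom Complex.ofRealHom Complex.I p = _
      rw [RingHom.map_det]
      congr 1
      ext i j
      simp [X, Y]
    rw [h0] at this
    simp at this
    exact ((Matrix.isUnit_iff_isUnit_det _).1 hU).ne_zero this.symm
  obtain ⟨s, hs⟩ : ∃ s, p.eval s ≠ 0 := by
    by_contra hcon
    push Not at hcon
    exact hp (Polynomial.funext (by simpa using hcon))
  refine ⟨X + s • Y, ?_, ?_⟩
  · rw [Matrix.isUnit_iff_isUnit_det, isUnit_iff_ne_zero]
    convert hs
    change _ = Polynomial.evalRingHom s p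
    rw [RingHom.map_det]
    congr 1
    ext i j
    simp
    exact mul_comm _ _
  · rw [add_mul, mul_add, hX, smul_mul_assoc, hY, mul_smul_comm]

open scoped MatrixOrder Matrix.Norms.L2Operator in
lemma exists_sqrt {ι : Type*} [Fintype ι] [DecidableEq ι] {M : Matrix ι ι ℝ} (hM : M.PosDef) :
    ∃ R R' : Matrix ι ι ℝ, Rᵀ = R ∧ R'ᵀ = R' ∧ R * R' = 1 ∧ R' * R = 1 ∧ R * R = M ∧
      ∀ X : Matrix ι ι ℝ, X * M = M * X → (X * R = R * X ∧ X * R' = R' * X) := by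
  have h0 : 0 ≤ M := hM.posSemidef.nonneg
  have hR : CFC.sqrt M * CFC.sqrt M = M := CFC.sqrt_mul_sqrt_self M h0
  have hu : IsUnit (CFC.sqrt M) := by
    have := hM.isUnit
    rw [← hR] at this
    exact isUnit_of_mul_isUnit_left this
  have ht : (CFC.sqrt M)ᵀ = CFC.sqrt M := by
    have : IsSelfAdjoint (CFC.sqrt M) := (CFC.sqrt_nonneg M).isSelfAdjoint
    simpa [IsSelfAdjoint, Matrix.star_eq_conjTranspose] using this
  have hc : ∀ X : Matrix ι ι ℝ, X * M = M * X → X * CFC.sqrt M = CFC.sqrt M * X := by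
    intro X hX
    have : Commute M X := hX.symm
    rw [CFC.sqrt]
    exact (Commute.cfcₙ_nnreal this _).symm
  obtain ⟨u, hu⟩ := hu
  rw [← hu] at hR ht hc
  refine ⟨u, (u⁻¹ : (Matrix ι ι ℝ)ˣ), ht, ?_, by simp, by simp, hR, ?_⟩
  · rw [Matrix.coe_units_inv, Matrix.transpose_nonsing_inv, ht]
  · intro X hX
    have : Commute X (u : Matrix ι ι ℝ) := hc X hX
    exact ⟨this, this.units_inv_right⟩

lemma orth_of_sim {ι : Type*} [Fintype ι] [DecidableEq ι] {C D T : Matrix ι ι ℝ}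
    (hC : Cᵀ = -C) (hD : Dᵀ = -D) (hT : IsUnit T) (h : T * C = D * T) :
    ∃ O : Matrix ι ι ℝ, O * Oᵀ = 1 ∧ O * C = D * O := by
  have hM : (Tᵀ * T).PosDef := by
    have := Matrix.PosDef.conjTranspose_mul_self T (Matrix.mulVec_injective_of_isUnit hT)
    simpa using this
  obtain ⟨R, R', hRt, hRt', hR1, hR2, hRR, hRc⟩ := exists_sqrt hM
  have h' : C * Tᵀ = Tᵀ * D := by
    have := congrArg transpose h
    simp [hC, hD] at this
    exact this
  have hc : C * R' = R' * C := (hRc C (by rw [← mul_assoc, h', mul_assoc, ← h, mul_assoc])).2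
  have key : (T * R')ᵀ * (T * R') = 1 := by
    rw [transpose_mul, hRt']
    calc (R' * Tᵀ) * (T * R') = R' * (Tᵀ * T) * R' := by simp only [mul_assoc]
    _ = (R' * R) * (R * R') := by rw [← hRR]; simp only [mul_assoc]
    _ = 1 := by simp [hR1, hR2]
  refine ⟨T * R', mul_eq_one_comm.1 key, ?_⟩
  rw [mul_assoc, ← hc, ← mul_assoc, h, mul_assoc]

lemma aeval_mulVec_eig {ι : Type*} [Fintype ι] [DecidableEq ι] {M : Matrix ι ι ℂ} {v : ι → ℂ} {c : ℂ}
    (h : M *ᵥ v = c • v) (p : Polynomial ℂ) :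
    (Polynomial.aeval M p) *ᵥ v = p.eval c • v := by
  induction p using Polynomial.induction_on with
  | C a => simp [Algebra.algebraMap_eq_smul_one, smul_mulVec]
  | add p q hp hq => simp [add_mulVec, add_smul, hp, hq]
  | monomial k a ih =>
    rw [pow_succ, ← mul_assoc, map_mul, Polynomial.aeval_X, ← mulVec_mulVec, h, mulVec_smul, ih,
      Polynomial.eval_mul (q := Polynomial.X), Polynomial.eval_X, smul_smul, mul_comm]

lemma grid {ι : Type*} [Fintype ι] [DecidableEq ι] {H K : Matrix ι ι ℂ}
    (hH : H.IsHermitian) (hK : K.IsHermitian) (hHK : H * K = K * H) (t : ℂ) (p : Polynomial ℂ)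
    (hp : ∀ a ∈ spectrum ℂ H, ∀ b ∈ spectrum ℂ K, p.eval (a + t * b) = a) :
    Polynomial.aeval (H + t • K) p = H := by
  set A := toEuclideanLin H with hA
  set B := toEuclideanLin K with hB
  have hcomm : Commute A B := by
    ext v i
    have := congrFun (congrArg (fun M => M *ᵥ (WithLp.ofLp v)) hHK) i
    simp only [← mulVec_mulVec] at this
    simpa [A, B] using this
  have htop := LinearMap.IsSymmetric.iSup_iSup_eigenspace_inf_eigenspace_eq_top_of_commute
    (isSymmetric_toEuclideanLin_iff.2 hH) (isSymmetric_toEuclideanLin_iff.2 hK) hcomm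
  set F := toEuclideanLin (Polynomial.aeval (H + t • K) p - H) with hF
  have hker : (⊤ : Submodule ℂ (EuclideanSpace ℂ ι)) ≤ LinearMap.ker F := by
    rw [← htop]
    refine iSup_le fun a => iSup_le fun b => ?_
    intro v hv
    obtain ⟨h1, h2⟩ := Submodule.mem_inf.1 hv
    by_cases hv0 : v = 0
    · simp [hv0]
    have ha : a ∈ spectrum ℂ H := by
      rw [← spectrum_toLpLin 2]
      exact (Module.End.hasEigenvalue_of_hasEigenvector ⟨h1, hv0⟩).mem_spectrum
    have hb : b ∈ spectrum ℂ K := by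
      rw [← spectrum_toLpLin 2]
      exact (Module.End.hasEigenvalue_of_hasEigenvector ⟨h2, hv0⟩).mem_spectrum
    rw [Module.End.mem_eigenspace_iff] at h1 h2
    have h1' : H *ᵥ v.ofLp = a • v.ofLp := by
      simpa [hA] using congrArg WithLp.ofLp h1
    have h2' : K *ᵥ v.ofLp = b • v.ofLp := by
      simpa [hB] using congrArg WithLp.ofLp h2
    have h3 : (H + t • K) *ᵥ v.ofLp = (a + t * b) • v.ofLp := by
      rw [add_mulVec, smul_mulVec, h1', h2', add_smul, smul_smul]
    have h4 := aeval_mulVec_eig h3 p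
    rw [hp a ha b hb] at h4
    rw [LinearMap.mem_ker]
    ext i
    simp [hF, h4, h1']
  have : F = 0 := by
    ext1 v
    exact LinearMap.mem_ker.1 (hker trivial)
  rw [hF] at this
  have := (LinearEquiv.map_eq_zero_iff _).1 this
  exact sub_eq_zero.1 this

lemma exists_generic (Sa Sb : Set ℂ) (ha : Sa.Finite) (hb : Sb.Finite) :
    ∃ t : ℝ, t ≠ 0 ∧ ∃ p : Polynomial ℂ, ∀ a ∈ Sa, ∀ b ∈ Sb, p.eval (a + t * b) = a := by
  classical
  obtain ⟨Sa, rfl⟩ := ha.exists_finset_coe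
  obtain ⟨Sb, rfl⟩ := hb.exists_finset_coe
  let G := Sa ×ˢ Sb
  let bad : Finset ℂ := insert 0 ((G ×ˢ G).image (fun x => (x.1.1 - x.2.1) / (x.2.2 - x.1.2)))
  have hfin : ((fun t : ℝ => (t : ℂ)) ⁻¹' (bad : Set ℂ)).Finite :=
    bad.finite_toSet.preimage Complex.ofReal_injective.injOn
  obtain ⟨t, ht⟩ := hfin.exists_notMem
  simp only [Set.mem_preimage, Finset.mem_coe, bad, Finset.mem_insert, not_or] at ht
  obtain ⟨ht0, ht⟩ := ht
  refine ⟨t, by exact_mod_cast ht0, Lagrange.interpolate G (fun x => x.1 + t * x.2) (fun x => x.1), ?_⟩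
  intro a ha b hb
  have hinj : Set.InjOn (fun x : ℂ × ℂ => x.1 + t * x.2) G := by
    intro x hx y hy hxy
    simp only at hxy
    by_cases h : x.2 = y.2
    · rw [h] at hxy
      exact Prod.ext (add_right_cancel hxy) h
    · exfalso
      apply ht
      refine Finset.mem_image.2 ⟨(x, y), Finset.mem_product.2 ⟨hx, hy⟩, ?_⟩
      have : y.2 - x.2 ≠ 0 := sub_ne_zero.2 (Ne.symm h)
      rw [div_eq_iff this]
      linear_combination hxy
  exact Lagrange.eval_interpolate_at_node (v := fun x : ℂ × ℂ => x.1 + t * x.2) (fun x => x.1) hinj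
    (i := (a, b)) (Finset.mem_product.2 ⟨ha, hb⟩)

lemma antisymm_herm {ι : Type*} {C : Matrix ι ι ℝ} (hC : Cᵀ = -C) :
    (Complex.I • C.map Complex.ofRealHom).IsHermitian := by
  ext i j
  have := congrFun (congrFun hC i) j
  simp at this
  simp [this]

/-- joint orthogonal equivalence -/
lemma joint_orth {ι : Type*} [Fintype ι] [DecidableEq ι] {A B C : Matrix ι ι ℝ}
    (hA : Aᵀ = -A) (hB : Bᵀ = -B) (hC : Cᵀ = -C) (hAB : A * B = B * A) (hAC : A * C = C * A)
    (h : ∀ k l : ℕ, (A ^ k * B ^ l).trace = (A ^ k * C ^ l).trace) :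
    ∃ O : Matrix ι ι ℝ, O * Oᵀ = 1 ∧ O * A = A * O ∧ O * B = C * O := by
  set c : Matrix ι ι ℝ → Matrix ι ι ℂ := fun M => Complex.I • M.map Complex.ofRealHom with hc
  obtain ⟨t, ht, p, hp⟩ := exists_generic (spectrum ℂ (c A)) (spectrum ℂ (c B) ∪ spectrum ℂ (c C))
    (Matrix.finite_spectrum _) ((Matrix.finite_spectrum _).union (Matrix.finite_spectrum _))
  have hcm : ∀ {M N : Matrix ι ι ℝ}, M * N = N * M → c M * c N = c N * c M := by
    intro M N h
    simp only [hc, smul_mul_assoc, mul_smul_comm, ← Matrix.map_mul, h]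
  have gB := grid (antisymm_herm hA) (antisymm_herm hB) (hcm hAB) t p
    (fun a ha b hb => hp a ha b (Or.inl hb))
  have gC := grid (antisymm_herm hA) (antisymm_herm hC) (hcm hAC) t p
    (fun a ha b hb => hp a ha b (Or.inr hb))
  have htr : ∀ k : ℕ, ((A + t • B) ^ k).trace = ((A + t • C) ^ k).trace := by
    intro k
    have cB : Commute A (t • B) := Commute.smul_right hAB t
    have cC : Commute A (t • C) := Commute.smul_right hAC t
    rw [cB.add_pow, cC.add_pow, trace_sum, trace_sum]
    refine Finset.sum_congr rfl fun m _ => ?_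
    simp only [smul_pow, mul_smul_comm, smul_mul_assoc, trace_smul]
    congr 1
    rw [← nsmul_eq_mul', ← nsmul_eq_mul', trace_smul, trace_smul, h]
  have s1 : (A + t • B)ᵀ = -(A + t • B) := by simp [hA, hB, add_comm]
  have s2 : (A + t • C)ᵀ = -(A + t • C) := by simp [hA, hC, add_comm]
  obtain ⟨T, hT, hTC⟩ := real_sim s1 s2 htr
  obtain ⟨O, hO, hOC⟩ := orth_of_sim s1 s2 hT hTC
  have e : ∀ M : Matrix ι ι ℝ, c A + (t:ℂ) • c M = c (A + t • M) := by
    intro M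
    ext i j
    simp [hc]; ring
  rw [show Complex.I • B.map Complex.ofRealHom = c B from rfl,
    show Complex.I • A.map Complex.ofRealHom = c A from rfl, e] at gB
  rw [show Complex.I • C.map Complex.ofRealHom = c C from rfl,
    show Complex.I • A.map Complex.ofRealHom = c A from rfl, e] at gC
  have hsc : SemiconjBy (O.map Complex.ofRealHom) (c (A + t • B)) (c (A + t • C)) := by
    simp only [SemiconjBy, hc, smul_mul_assoc, mul_smul_comm, ← Matrix.map_mul, hOC]
  have hsp : ∀ q : Polynomial ℂ, SemiconjBy (O.map Complex.ofRealHom)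
      (Polynomial.aeval (c (A + t • B)) q) (Polynomial.aeval (c (A + t • C)) q) := by
    intro q
    induction q using Polynomial.induction_on' with
    | add p q hp hq => rw [map_add, map_add]; exact hp.add_right hq
    | monomial k a =>
      rw [Polynomial.aeval_monomial, Polynomial.aeval_monomial]
      exact SemiconjBy.mul_right (Algebra.commutes a _).symm (hsc.pow_right k)
  have h1 := hsp p
  rw [gB, gC] at h1
  have hOA : O * A = A * O := by
    have h2 : (O * A).map Complex.ofRealHom = (A * O).map Complex.ofRealHom := by
      rw [Matrix.map_mul, Matrix.map_mul]
      have : Complex.I • (O.map Complex.ofRealHom * A.map Complex.ofRealHom) =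
        Complex.I • (A.map Complex.ofRealHom * O.map Complex.ofRealHom) := by
        simpa [SemiconjBy, hc] using h1
      exact smul_right_injective _ Complex.I_ne_zero this
    exact Matrix.map_injective Complex.ofRealHom.injective h2
  refine ⟨O, hO, hOA, ?_⟩
  rw [mul_add, add_mul, hOA] at hOC
  have := add_left_cancel hOC
  rw [mul_smul_comm, smul_mul_assoc] at this
  exact smul_right_injective _ ht this

section Proj
set_option linter.unusedSectionVars false
variable {ι : Type*} [Fintype ι] [DecidableEq ι]

lemma mat_ext {M N : Matrix ι ι ℝ} (h : ∀ v, M *ᵥ v = N *ᵥ v) : M = N :=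
  Matrix.ext_of_mulVec_single fun i => h _

/-- If `F` is symmetric, has its columns in the `q`-eigenspace of `K` and fixes that space,
then it commutes with everything commuting (together with its transpose) with `K`. -/
lemma proj_comm {K F M : Matrix ι ι ℝ} {q : ℝ} (hF : Fᵀ = F)
    (heig : K * F = q • F) (hfull : ∀ v, K *ᵥ v = q • v → F *ᵥ v = v)
    (h1 : M * K = K * M) (h2 : Mᵀ * K = K * Mᵀ) : M * F = F * M := by
  have key : ∀ M : Matrix ι ι ℝ, M * K = K * M → F * (M * F) = M * F := by
    intro M h
    apply mat_ext
    intro v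
    rw [← mulVec_mulVec]
    apply hfull
    rw [mulVec_mulVec, ← mul_assoc, ← h, mul_assoc, heig, mul_smul_comm, smul_mulVec]
  have k1 := key M h1
  have k2 := congrArg transpose (key _ h2)
  simp only [transpose_mul, transpose_transpose, hF] at k2
  rw [← k1, ← mul_assoc, k2]

structure IsProj (Q : Matrix ι ι ℝ) (P : ℝ → Matrix ι ι ℝ) : Prop where
  qs : Qᵀ = Q
  symm : ∀ q, (P q)ᵀ = P q
  idem : ∀ q, P q * P q = P q
  eig : ∀ q, Q * P q = q • P q
  full : ∀ (q : ℝ) (v : ι → ℝ), Q *ᵥ v = q • v → P q *ᵥ v = v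

variable {Q : Matrix ι ι ℝ} {P : ℝ → Matrix ι ι ℝ}

lemma IsProj.eig' (h : IsProj Q P) (q : ℝ) : P q * Q = q • P q := by
  have := congrArg transpose (h.eig q)
  simpa [h.qs, h.symm] using this

lemma IsProj.orth (h : IsProj Q P) {p q : ℝ} (hpq : p ≠ q) : P p * P q = 0 := by
  have h1 : P p * Q * P q = p • (P p * P q) := by rw [h.eig', smul_mul_assoc]
  have h2 : P p * Q * P q = q • (P p * P q) := by rw [mul_assoc, h.eig, mul_smul_comm]
  have h3 : (p - q) • (P p * P q) = 0 := by rw [sub_smul, ← h1, ← h2, sub_self]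
  exact (smul_eq_zero.1 h3).resolve_left (sub_ne_zero.2 hpq)

/-- projector onto the `q²`-eigenspace of `Q²` -/
def EE (P : ℝ → Matrix ι ι ℝ) (q : ℝ) : Matrix ι ι ℝ := if q = 0 then P 0 else P q + P (-q)

lemma EE_zero : EE P 0 = P 0 := by simp [EE]
lemma EE_pos {q : ℝ} (hq : 0 < q) : EE P q = P q + P (-q) := by simp [EE, hq.ne']

lemma IsProj.E_symm (h : IsProj Q P) (q : ℝ) : (EE P q)ᵀ = EE P q := by
  unfold EE; split_ifs <;> simp [h.symm]

lemma IsProj.E_eig (h : IsProj Q P) (q : ℝ) : (Q * Q) * EE P q = (q ^ 2) • EE P q := by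
  unfold EE; split_ifs with h0
  · simp [h0, mul_assoc, h.eig]
  · simp only [mul_add, mul_assoc, h.eig, mul_smul_comm, smul_smul, smul_add]
    congr 2 <;> ring

lemma IsProj.E_full (h : IsProj Q P) (q : ℝ) (v : ι → ℝ) (hv : (Q * Q) *ᵥ v = (q ^ 2) • v) :
    EE P q *ᵥ v = v := by
  unfold EE; split_ifs with h0
  · apply h.full
    subst h0
    rw [zero_smul]
    have : (Q *ᵥ v) ⬝ᵥ (Q *ᵥ v) = 0 := by
      have e : (Q *ᵥ v) ⬝ᵥ (Q *ᵥ v) = v ⬝ᵥ ((Q * Q) *ᵥ v) := by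
        rw [← mulVec_mulVec, dotProduct_mulVec v, ← mulVec_transpose, h.qs]
      rw [e, hv]; simp
    exact dotProduct_self_eq_zero.1 this
  · have hne : q ≠ -q := by
      intro hh; apply h0; linarith
    rw [← mulVec_mulVec] at hv
    have a1 : P q *ᵥ (Q *ᵥ v + q • v) = Q *ᵥ v + q • v := by
      apply h.full
      rw [mulVec_add, hv, mulVec_smul, smul_add, smul_smul, add_comm, pow_two]
    have a2 : P (-q) *ᵥ (Q *ᵥ v - q • v) = Q *ᵥ v - q • v := by
      apply h.full
      rw [mulVec_sub, hv, mulVec_smul, smul_sub, smul_smul, pow_two]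
      simp only [neg_smul, neg_mul]; abel
    have b1 : P (-q) *ᵥ (Q *ᵥ v + q • v) = 0 := by
      rw [← a1, mulVec_mulVec, h.orth hne.symm, zero_mulVec]
    have b2 : P q *ᵥ (Q *ᵥ v - q • v) = 0 := by
      rw [← a2, mulVec_mulVec, h.orth hne, zero_mulVec]
    have e : v = (2 * q)⁻¹ • ((Q *ᵥ v + q • v) - (Q *ᵥ v - q • v)) := by
      have : (Q *ᵥ v + q • v) - (Q *ᵥ v - q • v) = (2 * q) • v := by
        rw [mul_smul, two_smul]; abel
      rw [this, smul_smul, inv_mul_cancel₀ (by simpa using h0), one_smul]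
    conv_lhs => rw [e]
    rw [mulVec_smul, mulVec_sub, add_mulVec, add_mulVec, a1, a2, b1, b2]
    conv_rhs => rw [e]
    simp

lemma IsProj.E_comm (h : IsProj Q P) (q : ℝ) {M : Matrix ι ι ℝ}
    (h1 : M * (Q * Q) = (Q * Q) * M) (h2 : Mᵀ * (Q * Q) = (Q * Q) * Mᵀ) :
    M * EE P q = EE P q * M :=
  proj_comm (h.E_symm q) (h.E_eig q) (h.E_full q) h1 h2

lemma IsProj.E_orth (h : IsProj Q P) {p q : ℝ} (hp : 0 ≤ p) (hq : 0 ≤ q) (hpq : p ≠ q) :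
    EE P p * EE P q = 0 := by
  have hh : EE P p * (Q * Q) = (p ^ 2) • EE P p := by
    have := congrArg transpose (h.E_eig p)
    simpa [h.qs, h.E_symm] using this
  have h1 : EE P p * (Q * Q) * EE P q = (p ^ 2) • (EE P p * EE P q) := by rw [hh, smul_mul_assoc]
  have h2 : EE P p * (Q * Q) * EE P q = (q ^ 2) • (EE P p * EE P q) := by
    rw [mul_assoc, h.E_eig, mul_smul_comm]
  have h3 : (p ^ 2 - q ^ 2) • (EE P p * EE P q) = 0 := by rw [sub_smul, ← h1, ← h2, sub_self]
  refine (smul_eq_zero.1 h3).resolve_left (sub_ne_zero.2 ?_)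
  intro hc
  exact hpq ((sq_eq_sq₀ hp hq).1 hc)

lemma IsProj.resolution (h : IsProj Q P) :
    ∃ s : Finset ℝ, (∀ q ∈ s, 0 ≤ q) ∧ ∑ q ∈ s, EE P q = 1 := by
  have hH : Q.IsHermitian := by
    rw [IsHermitian, conjTranspose_eq_transpose_of_trivial, h.qs]
  let s : Finset ℝ := Finset.univ.image fun j => |hH.eigenvalues j|
  have hs : ∀ q ∈ s, 0 ≤ q := by
    intro q hq
    obtain ⟨j, -, rfl⟩ := Finset.mem_image.1 hq
    exact abs_nonneg _
  refine ⟨s, hs, ?_⟩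
  have hU : (∑ q ∈ s, EE P q) * (hH.eigenvectorUnitary : Matrix ι ι ℝ)
      = (hH.eigenvectorUnitary : Matrix ι ι ℝ) := by
    apply Matrix.ext_of_mulVec_single
    intro j
    rw [← mulVec_mulVec, hH.eigenvectorUnitary_mulVec]
    set v : ι → ℝ := ⇑(hH.eigenvectorBasis j)
    have hv : Q *ᵥ v = hH.eigenvalues j • v := hH.mulVec_eigenvectorBasis j
    have hm : |hH.eigenvalues j| ∈ s := Finset.mem_image.2 ⟨j, Finset.mem_univ _, rfl⟩
    have hE : EE P |hH.eigenvalues j| *ᵥ v = v := by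
      apply h.E_full
      rw [← mulVec_mulVec, hv, mulVec_smul, hv, smul_smul, sq_abs, pow_two]
    rw [sum_mulVec, Finset.sum_eq_single_of_mem _ hm, hE]
    intro q hq hne
    rw [← hE, mulVec_mulVec, h.E_orth (hs q hq) (abs_nonneg _) hne, zero_mulVec]
  have := congrArg (fun M => M * star (hH.eigenvectorUnitary : Matrix ι ι ℝ)) hU
  simpa [mul_assoc] using this

lemma IsProj.trace_eq (h : IsProj Q P) {X Y : Matrix ι ι ℝ}
    (h0 : (X * P 0).trace = (Y * P 0).trace)
    (hq : ∀ q, 0 < q → (X * (P q + P (-q))).trace = (Y * (P q + P (-q))).trace) :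
    X.trace = Y.trace := by
  obtain ⟨s, hs, h1⟩ := h.resolution
  rw [← mul_one X, ← mul_one Y, ← h1, Finset.mul_sum, Finset.mul_sum, trace_sum, trace_sum]
  refine Finset.sum_congr rfl fun q hqs => ?_
  rcases (hs q hqs).eq_or_lt with h' | h'
  · rw [← h', EE_zero]; exact h0
  · rw [EE_pos h']; exact hq q h'

variable {W : Matrix ι ι ℝ}

lemma A_sq (hWW : W * W = -1) (hQW : Q * W = W * Q) : (W * Q) * (W * Q) = - (Q * Q) := by
  rw [mul_assoc, ← mul_assoc Q, hQW, mul_assoc W, ← mul_assoc, hWW]; simp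

lemma comm_sq (hWW : W * W = -1) (hQW : Q * W = W * Q) {M : Matrix ι ι ℝ}
    (h : M * (W * Q) = (W * Q) * M) : M * (Q * Q) = (Q * Q) * M := by
  have e : Q * Q = - ((W * Q) * (W * Q)) := by rw [A_sq hWW hQW, neg_neg]
  have : Commute M (W * Q) := h
  rw [e]
  exact (this.mul_right this).neg_right

lemma trace_zero_block (h : IsProj Q P) (hWW : W * W = -1) (hWt : Wᵀ = -W) (hQW : Q * W = W * Q)
    {σ : Matrix ι ι ℝ} (hσ : σᵀ = σ) (hσc : σ * (W * Q) = (W * Q) * σ) (k l : ℕ) :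
    (((W * Q) ^ k) * (σ * W) ^ (l + 1) * P 0).trace
      = if k = 0 then ((σ * W * P 0) ^ (l + 1)).trace else 0 := by
  have c1 : Commute σ (P 0) := by
    have := h.E_comm 0 (comm_sq hWW hQW hσc) (by rw [hσ]; exact comm_sq hWW hQW hσc)
    rwa [EE_zero] at this
  have c2 : Commute W (P 0) :=
    proj_comm (h.symm 0) (h.eig 0) (h.full 0) hQW.symm (by rw [hWt]; simp [hQW])
  have c3 : Commute (σ * W) (P 0) := c1.mul_left c2
  have hid : IsIdempotentElem (P 0) := h.idem 0
  split_ifs with hk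
  · subst hk
    rw [c3.mul_pow, hid.pow_succ_eq, pow_zero, one_mul]
  · obtain ⟨k, rfl⟩ := Nat.exists_eq_succ_of_ne_zero hk
    have : Commute ((σ * W) ^ (l+1)) (P 0) := c3.pow_left _
    rw [mul_assoc, this.eq, ← mul_assoc, pow_succ, mul_assoc _ _ (P 0), mul_assoc W, h.eig]
    simp

lemma trace_pos_block (h : IsProj Q P) (hWW : W * W = -1) (hWt : Wᵀ = -W) (hQW : Q * W = W * Q)
    {σ : Matrix ι ι ℝ} (hσ : σᵀ = σ) (hσc : σ * (W * Q) = (W * Q) * σ) (k l m : ℕ)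
    (hkl : k + (l + 1) = 2 * m) {q : ℝ} (hq : 0 < q) :
    (((W * Q) ^ k) * (σ * W) ^ (l + 1) * (P q + P (-q))).trace
      = q ^ k * (-1) ^ m * ((σ * (P q - P (-q))) ^ (l + 1)).trace := by
  have hne : q ≠ -q := by linarith
  set E := P q + P (-q) with hE
  set Z := P q - P (-q) with hZ
  have o1 := h.orth hne
  have o2 := h.orth hne.symm
  have hEE : E * E = E := by
    simp [hE, add_mul, mul_add, o1, o2, h.idem]
  have hZZ : Z * Z = E := by
    simp [hE, hZ, sub_mul, mul_sub, o1, o2, h.idem]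
  have hZE : Z * E = Z := by
    rw [hE, hZ, mul_add, sub_mul, sub_mul, o1, o2, h.idem, h.idem]; abel
  have hEZ : E * Z = Z := by
    rw [hE, hZ, add_mul, mul_sub, mul_sub, o1, o2, h.idem, h.idem]; abel
  have hQE : Q * E = q • Z := by
    simp [hE, hZ, mul_add, h.eig, smul_sub, sub_eq_add_neg]
  have cW : ∀ r, Commute W (P r) := fun r =>
    proj_comm (h.symm r) (h.eig r) (h.full r) hQW.symm (by rw [hWt]; simp [hQW])
  have cWZ : Commute W Z := (cW q).sub_right (cW (-q))
  have cWE : Commute W E := (cW q).add_right (cW (-q))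
  have cσE : Commute σ E := by
    have := h.E_comm q (comm_sq hWW hQW hσc) (by rw [hσ]; exact comm_sq hWW hQW hσc)
    rwa [EE_pos hq] at this
  have hAE : (W * Q) * E = q • (W * Z) := by rw [mul_assoc, hQE, mul_smul_comm]
  set J := W * Z with hJ
  have cσA : Commute σ (W * Q) := hσc
  have cJσ : Commute J σ := by
    have h1 : Commute (q • J) σ := by
      rw [← hAE]; exact (cσA.mul_right cσE).symm
    have h2 := h1.smul_left q⁻¹
    rwa [smul_smul, inv_mul_cancel₀ hq.ne', one_smul] at h2
  have cJZ : Commute J Z := cWZ.mul_left (Commute.refl Z)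
  have cJE : Commute J E := cWE.mul_left (by rw [Commute, SemiconjBy, hZE, hEZ])
  have hJJ : J * J = -E := by
    rw [hJ, mul_assoc, ← mul_assoc Z, ← cWZ.eq, mul_assoc W, hZZ, ← mul_assoc, hWW]; simp
  have cσWE : Commute (σ * W) E := cσE.mul_left cWE
  have hσW : σ * W * E = J * (σ * Z) := by
    rw [← mul_assoc, cJσ.eq, mul_assoc σ J, hJ, mul_assoc W, hZZ, mul_assoc]
  have cAE : Commute (W * Q) E := by
    have hQE' : Commute Q E := by
      rw [Commute, SemiconjBy, hQE]
      simp [hE, hZ, add_mul, h.eig', smul_sub, sub_eq_add_neg]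
    exact cWE.mul_left hQE'
  have hid : IsIdempotentElem E := hEE
  have hpow : ∀ j, E ^ j * E = E := fun j => by rw [← pow_succ, hid.pow_succ_eq]
  have step1 : (W * Q) ^ k * (σ * W) ^ (l + 1) * E
      = ((W * Q) * E) ^ k * (σ * W * E) ^ (l + 1) * E := by
    have c4 : Commute (E ^ k) ((σ * W) ^ (l + 1)) := (cσWE.pow_pow _ _).symm
    rw [cAE.mul_pow, cσWE.mul_pow]
    calc (W * Q) ^ k * (σ * W) ^ (l + 1) * E
        = (W * Q) ^ k * ((σ * W) ^ (l + 1) * (E ^ k * (E ^ (l + 1) * E))) := by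
          rw [hpow, hpow, mul_assoc]
      _ = (W * Q) ^ k * (((σ * W) ^ (l + 1) * E ^ k) * (E ^ (l + 1) * E)) := by
          rw [mul_assoc ((σ * W) ^ (l + 1))]
      _ = _ := by rw [← c4.eq]; simp only [mul_assoc]
  have cJσZ : Commute J (σ * Z) := cJσ.mul_right cJZ
  have hZl : (σ * Z) ^ (l + 1) * E = (σ * Z) ^ (l + 1) := by
    rw [pow_succ, mul_assoc, mul_assoc σ, hZE]
  have cEσZ : Commute E (σ * Z) := cσE.symm.mul_right (by rw [Commute, SemiconjBy, hZE, hEZ])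
  have hJp : J ^ (2 * m) * (σ * Z) ^ (l + 1) = (-1 : ℝ) ^ m • (σ * Z) ^ (l + 1) := by
    have e : J ^ 2 = (-1 : ℝ) • E := by rw [pow_two, hJJ]; simp
    rw [pow_mul, e, smul_pow, smul_mul_assoc]
    congr 1
    rw [← hZl, ← ((cEσZ.pow_right (l+1))).eq, ← mul_assoc, hpow]
  rw [step1, hAE, hσW, cJσZ.mul_pow, smul_pow, smul_mul_assoc, smul_mul_assoc, ← mul_assoc (J ^ k),
    ← pow_add, hkl, mul_assoc _ _ E, hZl, hJp, smul_smul, trace_smul, smul_eq_mul]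

lemma converse_part (h : IsProj Q P) (hWW : W * W = -1) (hWt : Wᵀ = -W) (hQW : Q * W = W * Q)
    {σ₁ σ₂ : Matrix ι ι ℝ} (hσ₁ : σ₁ᵀ = σ₁) (hσ₁c : σ₁ * (W * Q) = (W * Q) * σ₁)
    (hσ₂ : σ₂ᵀ = σ₂) (hσ₂c : σ₂ * (W * Q) = (W * Q) * σ₂)
    (hp₁ : σ₁.PosDef) (hp₂ : σ₂.PosDef)
    (ha : ∀ k : ℕ, ((σ₁ * W * P 0) ^ k).trace = ((σ₂ * W * P 0) ^ k).trace)
    (hb : ∀ q : ℝ, 0 < q → ∀ k : ℕ,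
          ((σ₁ * (P q - P (-q))) ^ k).trace = ((σ₂ * (P q - P (-q))) ^ k).trace) :
    ∃ S : Matrix ι ι ℝ, S * W * Sᵀ = W ∧ S * Q * Sᵀ = Q ∧ S * σ₁ * Sᵀ = σ₂ := by
  obtain ⟨R, R', hRt, hRt', hR1, hR2, hRR, hRc⟩ := exists_sqrt hp₁
  obtain ⟨T, T', hTt, hTt', hT1, hT2, hTT, hTc⟩ := exists_sqrt hp₂
  set A := W * Q with hA
  have hAt : Aᵀ = -A := by rw [hA, transpose_mul, h.qs, hWt, mul_neg, hQW]
  have cAW : Commute A W := by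
    rw [Commute, SemiconjBy, hA, mul_assoc, hQW]
  have cAR : Commute A R := (hRc A hσ₁c.symm).1
  have cAR' : Commute A R' := (hRc A hσ₁c.symm).2
  have cAT : Commute A T := (hTc A hσ₂c.symm).1
  have hanti : ∀ {R : Matrix ι ι ℝ}, Rᵀ = R → (R * W * R)ᵀ = -(R * W * R) := by
    intro R hR
    simp [hR, hWt, mul_assoc]
  have hconj : ∀ {R R' σ : Matrix ι ι ℝ}, R' * R = 1 → R * R' = 1 → R * R = σ → Commute A R → ∀ k l : ℕ,
      (A ^ k * (R * W * R) ^ l).trace = (A ^ k * (σ * W) ^ l).trace := by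
    intro R R' σ h1 h2 h3 h4 k l
    have hs : SemiconjBy R (R * W * R) (σ * W) := by
      rw [SemiconjBy, ← h3]; simp only [mul_assoc]
    have hs' : SemiconjBy R (A ^ k * (R * W * R) ^ l) (A ^ k * (σ * W) ^ l) :=
      SemiconjBy.mul_right (h4.symm.pow_right k) (hs.pow_right l)
    calc (A ^ k * (R * W * R) ^ l).trace = ((R' * R) * (A ^ k * (R * W * R) ^ l)).trace := by
          rw [h1, one_mul]
      _ = (R' * ((A ^ k * (σ * W) ^ l) * R)).trace := by rw [mul_assoc, hs'.eq]
      _ = ((R * R') * (A ^ k * (σ * W) ^ l)).trace := by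
          rw [trace_mul_comm, mul_assoc, trace_mul_comm]
      _ = _ := by rw [h2, one_mul]
  have hodd : ∀ {B : Matrix ι ι ℝ}, Bᵀ = -B → ∀ k l : ℕ, Odd (k + l) → (A ^ k * B ^ l).trace = 0 := by
    intro B hB k l ho
    have e : (A ^ k * B ^ l).trace = -(A ^ k * B ^ l).trace := by
      conv_lhs => rw [← trace_transpose, transpose_mul, transpose_pow, transpose_pow, hB, hAt,
        trace_mul_comm, neg_pow, neg_pow B, mul_assoc, ← mul_assoc (A ^ k),
        ((Commute.neg_one_right (A ^ k)).pow_right l).eq, mul_assoc, ← mul_assoc, ← pow_add,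
        ho.neg_one_pow]
      simp
    linarith
  have htr : ∀ k l : ℕ, (A ^ k * (R * W * R) ^ l).trace = (A ^ k * (T * W * T) ^ l).trace := by
    intro k l
    rcases Nat.even_or_odd (k + l) with he | ho
    · rcases l with _ | l
      · simp
      rw [hconj hR2 hR1 hRR cAR, hconj hT2 hT1 hTT cAT]
      obtain ⟨m, hm⟩ := he
      rw [← two_mul] at hm
      apply h.trace_eq
      · rw [trace_zero_block h hWW hWt hQW hσ₁ hσ₁c, trace_zero_block h hWW hWt hQW hσ₂ hσ₂c, ha]
      · intro q hq
        rw [trace_pos_block h hWW hWt hQW hσ₁ hσ₁c k l m hm hq,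
          trace_pos_block h hWW hWt hQW hσ₂ hσ₂c k l m hm hq, hb q hq]
    · rw [hodd (hanti hRt) k l ho, hodd (hanti hTt) k l ho]
  obtain ⟨O, hO, hOA, hOB⟩ := joint_orth hAt (hanti hRt) (hanti hTt)
    ((cAR.mul_right cAW).mul_right cAR) ((cAT.mul_right cAW).mul_right cAT) htr
  have hG : ∀ {R R' : Matrix ι ι ℝ}, R * R' = 1 → (R * W * R) * (R' * W * R') = -1 := by
    intro R R' h1
    calc (R * W * R) * (R' * W * R') = R * W * (R * R') * W * R' := by simp only [mul_assoc]
      _ = R * (W * W) * R' := by rw [h1, mul_one]; simp only [mul_assoc]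
      _ = -1 := by rw [hWW]; simp [h1]
  have hG' : (T' * W * T') * (T * W * T) = -1 := by
    calc (T' * W * T') * (T * W * T) = T' * W * (T' * T) * W * T := by simp only [mul_assoc]
      _ = T' * (W * W) * T := by rw [hT2, mul_one]; simp only [mul_assoc]
      _ = -1 := by rw [hWW]; simp [hT2]
  have hOG : O * (R' * W * R') * Oᵀ = T' * W * T' := by
    have e : (T * W * T) * (O * (R' * W * R') * Oᵀ) = -1 := by
      calc (T * W * T) * (O * (R' * W * R') * Oᵀ) = ((T * W * T) * O) * (R' * W * R') * Oᵀ := by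
            simp only [mul_assoc]
        _ = O * ((R * W * R) * (R' * W * R')) * Oᵀ := by rw [← hOB]; simp only [mul_assoc]
        _ = -1 := by rw [hG hR1]; simp [hO]
    have e2 := congrArg (fun M => (T' * W * T') * M) e
    rw [← mul_assoc, hG'] at e2
    simpa using e2
  have hSW : (T * O * R') * W * (T * O * R')ᵀ = W := by
    rw [transpose_mul, transpose_mul, hRt', hTt]
    calc (T * O * R') * W * (R' * (Oᵀ * T)) = T * (O * (R' * W * R') * Oᵀ) * T := by
          simp only [mul_assoc]
      _ = (T * T') * W * (T' * T) := by rw [hOG]; simp only [mul_assoc]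
      _ = W := by rw [hT1, hT2]; simp
  refine ⟨T * O * R', hSW, ?_, ?_⟩
  · have hQ : Q = -(A * W) := by
      rw [hA, mul_assoc, hQW, ← mul_assoc, hWW]; simp
    have cOA : Commute A O := hOA.symm
    have cS : Commute A (T * O * R') := (cAT.mul_right cOA).mul_right cAR'
    conv_lhs => rw [hQ, mul_neg, ← mul_assoc, ← cS.eq, neg_mul, mul_assoc A, mul_assoc A, hSW, ← hQ]
  · rw [transpose_mul, transpose_mul, hRt', hTt, ← hRR, ← hTT]
    calc (T * O * R') * (R * R) * (R' * (Oᵀ * T)) = T * (O * ((R' * R) * (R * R')) * Oᵀ) * T := by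
          simp only [mul_assoc]
      _ = T * T := by rw [hR1, hR2]; simp [hO]

lemma trace_conj {S S' X Y : Matrix ι ι ℝ} (h : S' * S = 1) (hY : Y = S * X * S') (k : ℕ) :
    (X ^ k).trace = (Y ^ k).trace := by
  have hs : SemiconjBy S X Y := by
    rw [SemiconjBy, hY, mul_assoc, h, mul_one]
  have h2 : S * S' = 1 := mul_eq_one_comm.1 h
  have e : Y ^ k = S * X ^ k * S' := by
    rw [(hs.pow_right k).eq, mul_assoc, h2, mul_one]
  rw [e, trace_mul_cycle, h, one_mul]

lemma forward_part (h : IsProj Q P) (hWW : W * W = -1) (hWt : Wᵀ = -W) (hQW : Q * W = W * Q)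
    {σ₁ σ₂ S : Matrix ι ι ℝ} (hSW : S * W * Sᵀ = W) (hSQ : S * Q * Sᵀ = Q) (hSσ : S * σ₁ * Sᵀ = σ₂) :
    (∀ k : ℕ, ((σ₁ * W * P 0) ^ k).trace = ((σ₂ * W * P 0) ^ k).trace) ∧
    (∀ q : ℝ, 0 < q → ∀ k : ℕ,
          ((σ₁ * (P q - P (-q))) ^ k).trace = ((σ₂ * (P q - P (-q))) ^ k).trace) := by
  obtain ⟨S', hS'⟩ : ∃ S', S' = -(W * Sᵀ * W) := ⟨_, rfl⟩
  have h1 : S * S' = 1 := by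
    rw [hS', mul_neg, ← mul_assoc, ← mul_assoc, hSW, hWW, neg_neg]
  have h2 : S' * S = 1 := mul_eq_one_comm.1 h1
  have hWS : Sᵀ * W = W * S' := by
    rw [hS', mul_neg, ← mul_assoc, ← mul_assoc, hWW]; simp
  have hSAS : S * (W * Q) = (W * Q) * S := by
    have e1 : Q * Sᵀ = S' * Q := by
      rw [← hSQ, ← mul_assoc, ← mul_assoc, h2, one_mul]
      rw [hSQ]
    have e2 : S' * (Q * W) = (Q * W) * S' := by
      rw [← mul_assoc, ← e1, mul_assoc, hWS, mul_assoc]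
    rw [← hQW]
    calc S * (Q * W) = S * ((Q * W) * (S' * S)) := by rw [h2, mul_one]
      _ = S * (S' * (Q * W)) * S := by rw [e2]; simp only [mul_assoc]
      _ = (Q * W) * S := by rw [← mul_assoc, h1, one_mul]
  set A := W * Q with hA
  have hAt : Aᵀ = -A := by rw [hA, transpose_mul, h.qs, hWt, mul_neg, hQW]
  have hStA : Sᵀ * A = A * Sᵀ := by
    have := congrArg transpose hSAS
    simp [hAt] at this
    exact this.symm
  have inv_comm : ∀ {M : Matrix ι ι ℝ}, S * M = M * S → S' * M = M * S' := by
    intro M hM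
    calc S' * M = S' * (M * S) * S' := by rw [mul_assoc, mul_assoc, h1, mul_one]
      _ = (S' * S) * M * S' := by rw [← hM]; simp only [mul_assoc]
      _ = M * S' := by rw [h2, one_mul]
  have cE : ∀ q, S' * EE P q = EE P q * S' := fun q =>
    inv_comm (h.E_comm q (comm_sq hWW hQW hSAS) (comm_sq hWW hQW hStA))
  have hQS : Sᵀ * Q = Q * S' := by
    have hQ : Q = -(W * A) := by rw [hA, ← mul_assoc, hWW]; simp
    calc Sᵀ * Q = -((Sᵀ * W) * A) := by rw [mul_assoc, ← mul_neg, ← hQ]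
      _ = -(W * (S' * A)) := by rw [hWS, mul_assoc]
      _ = -(W * A) * S' := by rw [inv_comm hSAS, neg_mul, mul_assoc W A]
      _ = Q * S' := by rw [← hQ]
  refine ⟨fun k => trace_conj h2 ?_ k, fun q hq k => trace_conj h2 ?_ k⟩
  · have := cE 0
    rw [EE_zero] at this
    calc σ₂ * W * P 0 = S * σ₁ * (Sᵀ * W) * P 0 := by rw [← hSσ]; simp only [mul_assoc]
      _ = S * σ₁ * W * (S' * P 0) := by rw [hWS]; simp only [mul_assoc]
      _ = _ := by rw [this]; simp only [mul_assoc]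
  · have hc := cE q
    have hZ : q • (P q - P (-q)) = Q * EE P q := by
      rw [EE_pos hq]
      simp [mul_add, h.eig, smul_sub, sub_eq_add_neg]
    have e : q • (σ₂ * (P q - P (-q))) = q • (S * (σ₁ * (P q - P (-q))) * S') := by
      calc q • (σ₂ * (P q - P (-q))) = S * σ₁ * (Sᵀ * Q) * EE P q := by
            rw [← mul_smul_comm, hZ, ← hSσ]; simp only [mul_assoc]
        _ = S * σ₁ * Q * (S' * EE P q) := by rw [hQS]; simp only [mul_assoc]
        _ = S * (σ₁ * (Q * EE P q)) * S' := by rw [hc]; simp only [mul_assoc]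
        _ = _ := by rw [← hZ]; simp
    exact smul_right_injective _ hq.ne' e

end Proj

/-- Theorem 5.3 (complete set of conservation laws for incoherent Gaussian states):
for a real symmetric `Q` commuting with `Ω_n`, with spectral projectors `P q`, and real
symmetric positive-definite `σ₁, σ₂` commuting with `Ω_n * Q`, a symplectic `S` with
`S Q Sᵀ = Q` and `S σ₁ Sᵀ = σ₂` exists iff the listed trace conservation laws hold. -/
theorem conservation_laws_complete (n : ℕ)
    (Q σ₁ σ₂ : Matrix (Fin 2 × Fin n) (Fin 2 × Fin n) ℝ)
    (P : ℝ → Matrix (Fin 2 × Fin n) (Fin 2 × Fin n) ℝ)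
    (hQsymm : Q.IsSymm) (hQOmega : Q * OmegaN n = OmegaN n * Q)
    (hPsymm : ∀ q, (P q).IsSymm)
    (hPidem : ∀ q, P q * P q = P q)
    (hPeig : ∀ q, Q * P q = q • P q)
    (hPfull : ∀ (q : ℝ) (v : Fin 2 × Fin n → ℝ), Q.mulVec v = q • v → (P q).mulVec v = v)
    (hσ₁symm : σ₁.IsSymm) (hσ₁pd : σ₁.PosDef)
    (hσ₂symm : σ₂.IsSymm) (hσ₂pd : σ₂.PosDef)
    (hσ₁comm : σ₁ * (OmegaN n * Q) = (OmegaN n * Q) * σ₁)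
    (hσ₂comm : σ₂ * (OmegaN n * Q) = (OmegaN n * Q) * σ₂) :
    (∃ S : Matrix (Fin 2 × Fin n) (Fin 2 × Fin n) ℝ,
        IsSymplectic S ∧ S * Q * Sᵀ = Q ∧ S * σ₁ * Sᵀ = σ₂) ↔
      ((∀ k : ℕ, ((σ₁ * OmegaN n * P 0) ^ k).trace = ((σ₂ * OmegaN n * P 0) ^ k).trace) ∧
       (∀ q : ℝ, 0 < q → ∀ k : ℕ,
          ((σ₁ * (P q - P (-q))) ^ k).trace = ((σ₂ * (P q - P (-q))) ^ k).trace)) := by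
  have hproj : IsProj Q P := ⟨hQsymm, hPsymm, hPidem, hPeig, hPfull⟩
  constructor
  · rintro ⟨S, h1, h2, h3⟩
    exact forward_part hproj (OmegaN_sq n) (OmegaN_transpose n) hQOmega h1 h2 h3
  · rintro ⟨ha, hb⟩
    exact converse_part hproj (OmegaN_sq n) (OmegaN_transpose n) hQOmega hσ₁symm hσ₁comm
      hσ₂symm hσ₂comm hσ₁pd hσ₂pd ha hb
end
end

section
/- Lemma 5.1: Let A and B be (2n×2n) real matrices and let V be a symplectic matrix that commutes with Ω_n * B. Then for every element p of the free (noncommutative) ℝ-algebra on two generators, trace(ev_{A·Ω_n, Ω_n·B}(p)) = trace(ev_{(V·A·Vᵀ)·Ω_n, Ω_n·B}(p)). -/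
open Matrix

noncomputable section

/-- Lemma 5.1: for any noncommutative polynomial `p` in two variables,
`trace p(A Ω, Ω B)` is invariant under `A ↦ V A Vᵀ` for symplectic `V` commuting with `Ω B`. -/
theorem trace_polynomial_invariant (n : ℕ)
    (A B V : Matrix (Fin 2 × Fin n) (Fin 2 × Fin n) ℝ)
    (hV : IsSymplectic V)
    (hcomm : V * (OmegaN n * B) = (OmegaN n * B) * V)
    (p : FreeAlgebra ℝ (Fin 2)) :
    (FreeAlgebra.lift ℝ ![A * OmegaN n, OmegaN n * B] p).trace =
    (FreeAlgebra.lift ℝ ![(V * A * Vᵀ) * OmegaN n, OmegaN n * B] p).trace := by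
  have h1 : Omega1 * Omega1 = -1 := by
    ext i j
    fin_cases i <;> fin_cases j <;> simp [Omega1, Matrix.mul_apply, Fin.sum_univ_two]
  have hΩ : OmegaN n * OmegaN n = -1 := by
    unfold OmegaN
    rw [← Matrix.blockDiagonal_mul, ← Matrix.blockDiagonal_one, ← Matrix.blockDiagonal_neg]
    congr 1
    funext k
    exact h1
  unfold IsSymplectic at hV
  generalize OmegaN n = Ω at *
  obtain ⟨W, hW⟩ : ∃ W, W = -(Ω * Vᵀ * Ω) := ⟨_, rfl⟩
  have hVW : V * W = 1 := by
    calc V * W = -((V * Ω * Vᵀ) * Ω) := by rw [hW]; noncomm_ring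
      _ = 1 := by rw [hV, hΩ, neg_neg]
  have hWV : W * V = 1 := mul_eq_one_comm.mp hVW
  have hT : Vᵀ * Ω = Ω * W := by
    calc Vᵀ * Ω = -((-1) * (Vᵀ * Ω)) := by noncomm_ring
      _ = -((Ω * Ω) * (Vᵀ * Ω)) := by rw [hΩ]
      _ = Ω * W := by rw [hW]; noncomm_ring
  have key : FreeAlgebra.lift ℝ ![(V * A * Vᵀ) * Ω, Ω * B] p
      = V * FreeAlgebra.lift ℝ ![A * Ω, Ω * B] p * W := by
    induction p using FreeAlgebra.induction with
    | grade0 r =>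
      rw [AlgHom.commutes, AlgHom.commutes, ← Algebra.commutes, mul_assoc, hVW, mul_one]
    | grade1 x =>
      rw [FreeAlgebra.lift_ι_apply, FreeAlgebra.lift_ι_apply]
      fin_cases x
      · change V * A * Vᵀ * Ω = V * (A * Ω) * W
        rw [mul_assoc (V * A), hT]; noncomm_ring
      · change Ω * B = V * (Ω * B) * W
        rw [hcomm, mul_assoc, hVW, mul_one]
    | mul a b ha hb =>
      rw [map_mul, map_mul, ha, hb]
      generalize FreeAlgebra.lift ℝ ![A * Ω, Ω * B] a = x
      generalize FreeAlgebra.lift ℝ ![A * Ω, Ω * B] b = y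
      calc V * x * W * (V * y * W) = V * x * (W * V) * (y * W) := by noncomm_ring
        _ = V * (x * y) * W := by rw [hWV]; noncomm_ring
    | add a b ha hb =>
      rw [map_add, map_add, ha, hb, mul_add, add_mul]
  rw [key, Matrix.trace_mul_comm, ← mul_assoc, hWV, one_mul]
end
end

section
/- Proposition 3.2(iii) (existence of a pure invariant covariance matrix): Let G be a group and S : G → Matrix (2n×2n) ℝ a group homomorphism such that every S(g) is symplectic, and let R be a symplectic matrix such that R⁻¹ * S(g) * R is orthogonal for every g ∈ G. Then the matrix σ₀ := R * Rᵀ is symmetric, positive definite, satisfies σ₀ * Ω_n * σ₀ * Ω_n = −1 (i.e., σ₀ is the covariance matrix of a pure Gaussian state), and satisfies S(g) * σ₀ * S(g)ᵀ = σ₀ for all g ∈ G. -/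
open Matrix

noncomputable section

/-- Proposition 3.2(iii): if `R` is symplectic and `R⁻¹ S(g) R` is orthogonal for all `g`,
then `σ₀ = R Rᵀ` is a pure invariant covariance matrix. -/
theorem pure_invariant_state_exists (n : ℕ) {G : Type} [Group G]
    (S : G → Matrix (Fin 2 × Fin n) (Fin 2 × Fin n) ℝ)
    (hS1 : S 1 = 1) (hSmul : ∀ g h : G, S (g * h) = S g * S h)
    (hSsymp : ∀ g, IsSymplectic (S g))
    (R : Matrix (Fin 2 × Fin n) (Fin 2 × Fin n) ℝ)
    (hR : IsSymplectic R)
    (hO : ∀ g, (R⁻¹ * S g * R) * (R⁻¹ * S g * R)ᵀ = 1) :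
    (R * Rᵀ).IsSymm ∧ (R * Rᵀ).PosDef ∧
      (R * Rᵀ) * OmegaN n * (R * Rᵀ) * OmegaN n = -1 ∧
      ∀ g, S g * (R * Rᵀ) * (S g)ᵀ = R * Rᵀ := by
  have hΩ : OmegaN n * OmegaN n = -1 := by
    have h1 : Omega1 * Omega1 = -1 := by
      ext i j
      fin_cases i <;> fin_cases j <;> simp [Omega1]
    unfold OmegaN
    rw [← Matrix.blockDiagonal_mul]
    simp only [h1]
    have h2 : (fun _ : Fin n => (-1 : Matrix (Fin 2) (Fin 2) ℝ)) = -1 := rfl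
    rw [h2, Matrix.blockDiagonal_neg, Matrix.blockDiagonal_one]
  unfold IsSymplectic at hR
  have hinv : R * (OmegaN n * Rᵀ * (-OmegaN n)) = 1 := by
    have : R * (OmegaN n * Rᵀ * (-OmegaN n)) = -((R * OmegaN n * Rᵀ) * OmegaN n) := by
      simp [Matrix.mul_assoc]
    rw [this, hR, hΩ, neg_neg]
  have hinv2 := mul_eq_one_comm.mp hinv
  have hT : Rᵀ * OmegaN n * R = OmegaN n := by
    have h3 : OmegaN n * (OmegaN n * Rᵀ * (-OmegaN n) * R)
        = -((OmegaN n * OmegaN n) * (Rᵀ * OmegaN n * R)) := by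
      simp [Matrix.mul_assoc]
    rw [hinv2, hΩ] at h3
    simpa using h3.symm
  have hdet : IsUnit R.det := Matrix.isUnit_det_of_right_inverse hinv
  have hRR : R * R⁻¹ = 1 := Matrix.mul_nonsing_inv R hdet
  refine ⟨?_, ?_, ?_, ?_⟩
  · simp [Matrix.IsSymm]
  · have hU : IsUnit R := (Matrix.isUnit_iff_isUnit_det R).mpr hdet
    have := Matrix.PosDef.mul_conjTranspose_self R (Matrix.vecMul_injective_of_isUnit hU)
    rwa [Matrix.conjTranspose_eq_transpose_of_trivial] at this
  · calc (R * Rᵀ) * OmegaN n * (R * Rᵀ) * OmegaN n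
        = R * (Rᵀ * OmegaN n * R) * Rᵀ * OmegaN n := by simp only [Matrix.mul_assoc]
      _ = -1 := by rw [hT, hR, hΩ]
  · intro g
    have h4 : R * (R⁻¹ * S g * R) = S g * R := by
      rw [← Matrix.mul_assoc, ← Matrix.mul_assoc, hRR, Matrix.one_mul]
    calc S g * (R * Rᵀ) * (S g)ᵀ = (S g * R) * (S g * R)ᵀ := by
          simp only [Matrix.transpose_mul, Matrix.mul_assoc]
      _ = R * ((R⁻¹ * S g * R) * (R⁻¹ * S g * R)ᵀ) * Rᵀ := by
          rw [← h4, Matrix.transpose_mul R]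
          simp only [Matrix.mul_assoc]
      _ = R * Rᵀ := by rw [hO, Matrix.mul_one]
end
end

section
/- Proposition 5.5 (normal mode decomposition by passive transformations): Let σ be a (2n×2n) real symmetric positive-definite matrix. Then σ commutes with Ω_n if and only if there exists a matrix S that is simultaneously symplectic and orthogonal, together with strictly positive reals ν_1,…,ν_n, such that S * σ * Sᵀ = blockdiag(ν_j·I₂). -/
open Matrix

noncomputable section

/-- Realification of a complex matrix: `i` is sent to `Ω`. -/
def realify {n : ℕ} (M : Matrix (Fin n) (Fin n) ℂ) :
    Matrix (Fin 2 × Fin n) (Fin 2 × Fin n) ℝ :=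
  fun p q => if p.1 = q.1 then (M p.2 q.2).re
    else if p.1 = 0 then (M p.2 q.2).im else -(M p.2 q.2).im

lemma realify_mul {n : ℕ} (M N : Matrix (Fin n) (Fin n) ℂ) :
    realify (M * N) = realify M * realify N := by
  ext ⟨a, i⟩ ⟨b, j⟩
  fin_cases a <;> fin_cases b <;>
    simp [realify, Matrix.mul_apply, Fintype.sum_prod_type, Fin.sum_univ_two, Complex.re_sum,
      Complex.im_sum, ← Finset.sum_add_distrib, ← Finset.sum_neg_distrib, ← Finset.sum_sub_distrib] <;>
    refine Finset.sum_congr rfl fun k _ => by ring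

lemma realify_conjTranspose {n : ℕ} (M : Matrix (Fin n) (Fin n) ℂ) :
    realify Mᴴ = (realify M)ᵀ := by
  ext ⟨a, i⟩ ⟨b, j⟩
  fin_cases a <;> fin_cases b <;> simp [realify]

lemma realify_diagonal {n : ℕ} (d : Fin n → ℝ) :
    realify (Matrix.diagonal fun j => (d j : ℂ)) =
      Matrix.blockDiagonal (fun j => (d j) • (1 : Matrix (Fin 2) (Fin 2) ℝ)) := by
  ext ⟨a, i⟩ ⟨b, j⟩
  by_cases h : i = j
  · subst h
    fin_cases a <;> fin_cases b <;> simp [realify, Matrix.blockDiagonal_apply]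
  · fin_cases a <;> fin_cases b <;> simp [realify, Matrix.blockDiagonal_apply, h]

lemma realify_one {n : ℕ} : realify (1 : Matrix (Fin n) (Fin n) ℂ) = 1 := by
  have := realify_diagonal (n := n) (fun _ => 1)
  simp only [Complex.ofReal_one, Matrix.diagonal_one, one_smul] at this
  rw [this]
  exact Matrix.blockDiagonal_one

lemma realify_I {n : ℕ} :
    realify (Complex.I • (1 : Matrix (Fin n) (Fin n) ℂ)) = OmegaN n := by
  ext ⟨a, i⟩ ⟨b, j⟩
  by_cases h : i = j
  · subst h
    fin_cases a <;> fin_cases b <;>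
      simp [realify, OmegaN, Omega1, Matrix.blockDiagonal_apply]
  · fin_cases a <;> fin_cases b <;>
      simp [realify, OmegaN, Omega1, Matrix.blockDiagonal_apply, h]

lemma exists_realify {n : ℕ} (σ : Matrix (Fin 2 × Fin n) (Fin 2 × Fin n) ℝ)
    (hσ : σ.IsSymm) (h : σ * OmegaN n = OmegaN n * σ) :
    ∃ H : Matrix (Fin n) (Fin n) ℂ, H.IsHermitian ∧ realify H = σ := by
  have h1 : ∀ i j, σ (1, i) (1, j) = σ (0, i) (0, j) := by
    intro i j
    have := congrFun (congrFun h (0, i)) (1, j)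
    simp [Matrix.mul_apply, Fintype.sum_prod_type, OmegaN, Omega1,
      Matrix.blockDiagonal_apply] at this
    linarith
  have h2 : ∀ i j, σ (1, i) (0, j) = - σ (0, i) (1, j) := by
    intro i j
    have := congrFun (congrFun h (0, i)) (0, j)
    simp [Matrix.mul_apply, Fintype.sum_prod_type, OmegaN, Omega1,
      Matrix.blockDiagonal_apply] at this
    linarith
  have hs : ∀ p q, σ p q = σ q p := fun p q => hσ.apply q p
  refine ⟨fun i j => ⟨σ (0, i) (0, j), σ (0, i) (1, j)⟩, ?_, ?_⟩
  · ext i j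
    apply Complex.ext
    · exact hs _ _
    · have := hs (1, i) (0, j)
      rw [h2] at this
      change -σ (0, j) (1, i) = σ (0, i) (1, j)
      linarith
  · ext ⟨a, i⟩ ⟨b, j⟩
    fin_cases a <;> fin_cases b <;> simp [realify, h1, h2]

/-- Proposition 5.5: a real symmetric positive-definite `σ` commutes with `Ω_n` iff it can be
brought to normal mode form `blockdiag(ν_j · I₂)` (with `ν_j > 0`) by a matrix that is
simultaneously symplectic and orthogonal (i.e. passive). -/
theorem passive_normal_mode_decomposition (n : ℕ)
    (σ : Matrix (Fin 2 × Fin n) (Fin 2 × Fin n) ℝ)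
    (hσsymm : σ.IsSymm) (hσpd : σ.PosDef) :
    σ * OmegaN n = OmegaN n * σ ↔
      ∃ S : Matrix (Fin 2 × Fin n) (Fin 2 × Fin n) ℝ,
        IsSymplectic S ∧ S * Sᵀ = 1 ∧
        ∃ ν : Fin n → ℝ, (∀ j, 0 < ν j) ∧
          S * σ * Sᵀ = Matrix.blockDiagonal (fun j => (ν j) • (1 : Matrix (Fin 2) (Fin 2) ℝ)) := by
  constructor
  · intro h
    obtain ⟨H, hH, rfl⟩ := exists_realify σ hσsymm h
    let U : Matrix (Fin n) (Fin n) ℂ := hH.eigenvectorUnitary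
    have hU : Uᴴ * U = 1 := Matrix.mem_unitaryGroup_iff'.1 hH.eigenvectorUnitary.2
    have hD : Uᴴ * H * U = Matrix.diagonal fun j => (hH.eigenvalues j : ℂ) := by
      have h3 : H = U * (Matrix.diagonal fun j => (hH.eigenvalues j : ℂ)) * Uᴴ := by
        conv_lhs => rw [hH.spectral_theorem]
        rfl
      conv_lhs => rw [h3]
      rw [show ∀ D : Matrix (Fin n) (Fin n) ℂ,
        Uᴴ * (U * D * Uᴴ) * U = (Uᴴ * U) * D * (Uᴴ * U) by intro D; simp only [Matrix.mul_assoc], hU]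
      simp
    have hT : (realify Uᴴ)ᵀ = realify U := by rw [← realify_conjTranspose]; simp
    have hS : realify Uᴴ * (realify Uᴴ)ᵀ = 1 := by
      rw [hT, ← realify_mul, hU, realify_one]
    have hSD : realify Uᴴ * realify H * (realify Uᴴ)ᵀ =
        Matrix.blockDiagonal (fun j => (hH.eigenvalues j) • (1 : Matrix (Fin 2) (Fin 2) ℝ)) := by
      rw [hT, ← realify_mul, ← realify_mul, hD, realify_diagonal]
    refine ⟨realify Uᴴ, ?_, hS, hH.eigenvalues, ?_, hSD⟩
    · unfold IsSymplectic
      rw [hT, ← realify_I, ← realify_mul, ← realify_mul]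
      simp [hU]
    · intro j
      have hpd : (realify Uᴴ * realify H * (realify Uᴴ)ᵀ).PosDef := by
        have := hσpd.mul_mul_conjTranspose_same (B := realify Uᴴ)
          (Matrix.vecMul_injective_of_isUnit (IsUnit.of_mul_eq_one _ hS))
        simpa [Matrix.conjTranspose_eq_transpose_of_trivial] using this
      rw [hSD] at hpd
      simpa [Matrix.blockDiagonal_apply] using hpd.diag_pos (i := ((0 : Fin 2), j))
  · rintro ⟨S, hΩ, hS, ν, -, hD⟩
    have hS' : Sᵀ * S = 1 := mul_eq_one_comm.1 hS
    unfold IsSymplectic at hΩ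
    have hc : S * OmegaN n = OmegaN n * S := by
      calc S * OmegaN n = S * OmegaN n * (Sᵀ * S) := by rw [hS', Matrix.mul_one]
        _ = (S * OmegaN n * Sᵀ) * S := by simp only [Matrix.mul_assoc]
        _ = _ := by rw [hΩ]
    have hc' : Sᵀ * OmegaN n = OmegaN n * Sᵀ := by
      calc Sᵀ * OmegaN n = Sᵀ * (S * OmegaN n * Sᵀ) := by rw [hΩ]
        _ = (Sᵀ * S) * OmegaN n * Sᵀ := by simp only [Matrix.mul_assoc]
        _ = _ := by rw [hS', Matrix.one_mul]
    set D := Matrix.blockDiagonal (fun j => (ν j) • (1 : Matrix (Fin 2) (Fin 2) ℝ)) with hDdef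
    have hDc : D * OmegaN n = OmegaN n * D := by
      rw [hDdef, OmegaN, ← Matrix.blockDiagonal_mul, ← Matrix.blockDiagonal_mul]
      simp
    have hσ : σ = Sᵀ * D * S := by
      rw [← hD]
      calc σ = (Sᵀ * S) * σ * (Sᵀ * S) := by rw [hS']; simp
        _ = _ := by simp only [Matrix.mul_assoc]
    rw [hσ]
    calc Sᵀ * D * S * OmegaN n = Sᵀ * D * (S * OmegaN n) := by simp only [Matrix.mul_assoc]
      _ = Sᵀ * (D * OmegaN n) * S := by rw [hc]; simp only [Matrix.mul_assoc]
      _ = (Sᵀ * OmegaN n) * D * S := by rw [hDc]; simp only [Matrix.mul_assoc]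
      _ = _ := by rw [hc']; simp only [Matrix.mul_assoc]
end
end

section
/- Proposition B.2 (invariance of the transpose under squeezed passive representations): Let G be a group and O : G → Matrix (2n×2n) ℝ a group homomorphism such that every O(g) is orthogonal and symplectic. Let R be a symplectic matrix and define S(g) := R * O(g) * R⁻¹ for each g ∈ G. Let C := { M : Matrix (2n×2n) ℝ | ∀ g ∈ G, M * O(g) = O(g) * M } be the commutant of the representation O, and assume (Rᵀ * R) normalizes C, i.e., { (Rᵀ·R) * M * (Rᵀ·R)⁻¹ | M ∈ C } = C. Then for every (2n×2n) real matrix V: if V * S(g) = S(g) * V for all g ∈ G, then Vᵀ * S(g) = S(g) * Vᵀ for all g ∈ G. -/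
open Matrix

noncomputable section

/-- Proposition B.2: for a squeezed passive representation `S(g) = R O(g) R⁻¹` such that
`Rᵀ R` normalizes the commutant of the passive representation `O`, any matrix commuting
with the representation has its transpose also commuting with the representation. -/
theorem transpose_invariant_of_normalizer (n : ℕ) {G : Type} [Group G]
    (O : G → Matrix (Fin 2 × Fin n) (Fin 2 × Fin n) ℝ)
    (hO1 : O 1 = 1) (hOmul : ∀ g h : G, O (g * h) = O g * O h)
    (hOorth : ∀ g, O g * (O g)ᵀ = 1) (hOsymp : ∀ g, IsSymplectic (O g))
    (R : Matrix (Fin 2 × Fin n) (Fin 2 × Fin n) ℝ) (hR : IsSymplectic R)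
    (hnorm : (fun M => (Rᵀ * R) * M * (Rᵀ * R)⁻¹) ''
        {M : Matrix (Fin 2 × Fin n) (Fin 2 × Fin n) ℝ | ∀ g, M * O g = O g * M} =
      {M : Matrix (Fin 2 × Fin n) (Fin 2 × Fin n) ℝ | ∀ g, M * O g = O g * M})
    (V : Matrix (Fin 2 × Fin n) (Fin 2 × Fin n) ℝ)
    (hV : ∀ g, V * (R * O g * R⁻¹) = (R * O g * R⁻¹) * V) :
    ∀ g, Vᵀ * (R * O g * R⁻¹) = (R * O g * R⁻¹) * Vᵀ := by
  have hdetΩ : (OmegaN n).det = 1 := by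
    simp [OmegaN, Matrix.det_blockDiagonal, Omega1, Matrix.det_fin_two]
  have hRu : IsUnit R.det := by
    have h := congrArg Matrix.det hR
    rw [Matrix.det_mul, Matrix.det_mul, hdetΩ, Matrix.det_transpose, mul_one] at h
    exact IsUnit.of_mul_eq_one _ h
  have hRL : R * R⁻¹ = 1 := Matrix.mul_nonsing_inv R hRu
  have hLR : R⁻¹ * R = 1 := Matrix.nonsing_inv_mul R hRu
  have hinv : (Rᵀ * R)⁻¹ = R⁻¹ * (R⁻¹)ᵀ := by
    rw [Matrix.mul_inv_rev, Matrix.transpose_nonsing_inv]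
  generalize R⁻¹ = L at *
  have hT1 : Lᵀ * Rᵀ = 1 := by rw [← Matrix.transpose_mul, hRL, Matrix.transpose_one]
  have hOT : ∀ g, (O g)ᵀ = O g⁻¹ := by
    intro g
    have h1 : O g⁻¹ * O g = 1 := by rw [← hOmul, inv_mul_cancel, hO1]
    calc (O g)ᵀ = (O g⁻¹ * O g) * (O g)ᵀ := by rw [h1, one_mul]
      _ = O g⁻¹ := by rw [mul_assoc, hOorth, mul_one]
  have hM : ∀ g, (L * V * R) * O g = O g * (L * V * R) := by
    intro g
    calc (L * V * R) * O g = L * (V * (R * O g * L)) * R := by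
          simp only [mul_assoc, hLR, mul_one]
      _ = (L * R) * O g * (L * V * R) := by rw [hV g]; simp only [mul_assoc]
      _ = _ := by rw [hLR, one_mul]
  have hMT : ∀ g, (L * V * R)ᵀ * O g = O g * (L * V * R)ᵀ := by
    intro g
    have h := congrArg Matrix.transpose (hM g⁻¹)
    rw [Matrix.transpose_mul, Matrix.transpose_mul _ (L * V * R), hOT, inv_inv] at h
    exact h.symm
  have hmem : (L * V * R)ᵀ ∈ {M : Matrix (Fin 2 × Fin n) (Fin 2 × Fin n) ℝ |
      ∀ g, M * O g = O g * M} := hMT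
  rw [← hnorm] at hmem
  obtain ⟨N, hN, hNe⟩ := hmem
  have hN' : ∀ g, N * O g = O g * N := hN
  simp only [hinv, Matrix.transpose_mul] at hNe
  have hVT : Vᵀ = R * N * L := by
    calc Vᵀ = (Lᵀ * Rᵀ) * Vᵀ * (Lᵀ * Rᵀ) := by rw [hT1, one_mul, mul_one]
      _ = Lᵀ * (Rᵀ * (Vᵀ * Lᵀ)) * Rᵀ := by simp only [mul_assoc]
      _ = (Lᵀ * Rᵀ) * (R * N * L) * (Lᵀ * Rᵀ) := by rw [← hNe]; simp only [mul_assoc]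
      _ = _ := by rw [hT1, one_mul, mul_one]
  intro g
  rw [hVT]
  calc R * N * L * (R * O g * L) = R * N * (L * R) * O g * L := by simp only [mul_assoc]
    _ = R * (N * O g) * L := by rw [hLR, mul_one]; simp only [mul_assoc]
    _ = R * O g * (L * R) * N * L := by rw [hN', hLR, mul_one]; simp only [mul_assoc]
    _ = _ := by simp only [mul_assoc]
end
end
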